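/- Let ℓ, ℓ' be geodesic lines of ℍ transversely oriented by connected components U of ℍ∖ℓ and U' of ℍ∖ℓ', and let g, g' ∈ PSL(2,ℝ). Then the closed right crooked half-spaces g·H̄*₊(ℓ,U) and g'·H̄*₊(ℓ',U') are disjoint if and only if the following all hold: there exists K > 0 with d(g·x, g'·x') ≤ d(x, x') − K for all x ∈ ℓ and x' ∈ ℓ'; ℓ' ∩ U = ∅; and ℓ ∩ U' = ∅ (i.e. ℓ and ℓ' are transversely oriented away from each other). -/

import Mathlib

noncomputable section

open Filter Topology Pointwise
open scoped UpperHalfPlane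

/-- `SL(2,ℝ)`. -/
abbrev SL2 := Matrix.SpecialLinearGroup (Fin 2) ℝ

instance : TopologicalSpace SL2 :=
  TopologicalSpace.induced (fun A : SL2 => (A : Matrix (Fin 2) (Fin 2) ℝ)) inferInstance

/-- `PSL(2,ℝ) = SL(2,ℝ)/{±I}`. -/
abbrev PSL2 := SL2 ⧸ Subgroup.center SL2

/-- The Möbius action of an element of `PSL(2,ℝ)` on the upper half-plane,
computed via an (arbitrary) lift to `SL(2,ℝ)`; this is well defined since
`-I` acts trivially. -/
def pslSMul (g : PSL2) (z : ℍ) : ℍ := (Quotient.out g) • z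

/-- Image of a subset of `ℍ` under the Möbius action of `g ∈ PSL(2,ℝ)`. -/
def pslImg (g : PSL2) (s : Set ℍ) : Set ℍ := pslSMul g '' s

/-- A geodesic line of `ℍ`: the image of an isometric embedding of `ℝ` into `ℍ`. -/
def IsGeodesicLine (l : Set ℍ) : Prop := ∃ γ : ℝ → ℍ, Isometry γ ∧ Set.range γ = l

/-- The embedding of `ℍ` into the one-point compactification of `ℂ`. -/
def embH (z : ℍ) : OnePoint ℂ := ((z : ℂ) : OnePoint ℂ)

/-- The embedding of `∂∞ℍ = ℝ ∪ {∞}` into the one-point compactification of `ℂ`. -/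
def toC : OnePoint ℝ → OnePoint ℂ := OnePoint.map Complex.ofReal

/-- The vector `v(ξ) ∈ ℝ²` associated with a boundary point `ξ ∈ ℝ ∪ {∞}`:
`v(ξ) = (ξ, 1)` for `ξ ∈ ℝ` and `v(∞) = (1, 0)`. -/
def bvec (ξ : OnePoint ℝ) : Fin 2 → ℝ := Option.elim ξ ![1, 0] (fun r => ![r, 1])

/-- The extended Möbius action of `PSL(2,ℝ)` on `∂∞ℍ = ℝ ∪ {∞}`. -/
def bdSMul (g : PSL2) (ξ : OnePoint ℝ) : OnePoint ℝ :=
  let w := ((Quotient.out g : SL2) : Matrix (Fin 2) (Fin 2) ℝ).mulVec (bvec ξ)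
  if w 1 = 0 then OnePoint.infty else ((w 0 / w 1 : ℝ) : OnePoint ℝ)

/-- `ξ ∈ ℝ ∪ {∞}` is an endpoint of the geodesic line `l`: some isometric
parametrization of `l` tends to `ξ` (in the one-point compactification of `ℂ`). -/
def IsEndpoint (l : Set ℍ) (ξ : OnePoint ℝ) : Prop :=
  ∃ γ : ℝ → ℍ, Isometry γ ∧ Set.range γ = l ∧
    Tendsto (fun t => embH (γ t)) atTop (𝓝 (toC ξ))

/-- `h ∈ PSL(2,ℝ)` has a nonattracting fixed point at `ξ ∈ ℝ ∪ {∞}`. -/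
def HasNonattracting (h : PSL2) (ξ : OnePoint ℝ) : Prop :=
  ∃ A : SL2, (QuotientGroup.mk A : PSL2) = h ∧
    ∃ μ : ℝ, |μ| ≤ 1 ∧ (A : Matrix (Fin 2) (Fin 2) ℝ).mulVec (bvec ξ) = μ • bvec ξ

/-- `h ∈ PSL(2,ℝ)` has a nonrepelling fixed point at `ξ ∈ ℝ ∪ {∞}`. -/
def HasNonrepelling (h : PSL2) (ξ : OnePoint ℝ) : Prop :=
  ∃ A : SL2, (QuotientGroup.mk A : PSL2) = h ∧
    ∃ μ : ℝ, 1 ≤ |μ| ∧ (A : Matrix (Fin 2) (Fin 2) ℝ).mulVec (bvec ξ) = μ • bvec ξ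

/-- The right AdS crooked plane `C*(l)` centered at the identity. -/
def rightCrooked (l : Set ℍ) : Set PSL2 :=
  {h | (∃ x ∈ l, pslSMul h x = x) ∨ ∃ ξ, IsEndpoint l ξ ∧ HasNonattracting h ξ}

/-- The left AdS crooked plane `C(l)` centered at the identity. -/
def leftCrooked (l : Set ℍ) : Set PSL2 :=
  {h | (∃ x ∈ l, pslSMul h x = x) ∨ ∃ ξ, IsEndpoint l ξ ∧ HasNonrepelling h ξ}

/-- A general right AdS crooked plane: a set of the form `g·C*(l)`. -/
def IsRightCrookedPlane (S : Set PSL2) : Prop :=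
  ∃ (g : PSL2) (l : Set ℍ), IsGeodesicLine l ∧ S = (g * ·) '' rightCrooked l

/-- A general left AdS crooked plane: a set of the form `C(l)·g`. -/
def IsLeftCrookedPlane (S : Set PSL2) : Prop :=
  ∃ (g : PSL2) (l : Set ℍ), IsGeodesicLine l ∧ S = (· * g) '' leftCrooked l

variable {Γ : Type*} [Group Γ]

/-- The action `γ·x = ρ(γ) x j(γ)⁻¹` of `Γ` on `PSL(2,ℝ)`, applied to a set. -/
def actImg (j ρ : Γ →* PSL2) (γ : Γ) (S : Set PSL2) : Set PSL2 :=
  (fun x => ρ γ * x * (j γ)⁻¹) '' S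

/-- The action `γ·x = ρ(γ) x j(γ)⁻¹` is properly discontinuous. -/
def ProperlyDisc (j ρ : Γ →* PSL2) : Prop :=
  ∀ K : Set PSL2, IsCompact K → {γ : Γ | (actImg j ρ γ K ∩ K).Nonempty}.Finite

/-- `R` is a fundamental domain for the action `γ·x = ρ(γ) x j(γ)⁻¹`:
`R` is closed, its translates cover `PSL(2,ℝ)`, and the interiors of the
translates are pairwise disjoint. -/
def IsFundDom (j ρ : Γ →* PSL2) (R : Set PSL2) : Prop :=
  IsClosed R ∧ (⋃ γ : Γ, actImg j ρ γ R) = Set.univ ∧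
    Pairwise fun γ₁ γ₂ : Γ =>
      Disjoint (interior (actImg j ρ γ₁ R)) (interior (actImg j ρ γ₂ R))

/-- The action admits a fundamental domain bounded by pairwise disjoint
right AdS crooked planes. -/
def AdmitsRightCrookedFD (j ρ : Γ →* PSL2) : Prop :=
  ∃ (m : ℕ) (D : Fin m → Set PSL2), (∀ i, IsRightCrookedPlane (D i)) ∧
    (∀ (γ γ' : Γ) (i i' : Fin m),
      actImg j ρ γ (D i) = actImg j ρ γ' (D i') ∨
      Disjoint (actImg j ρ γ (D i)) (actImg j ρ γ' (D i'))) ∧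
    ∃ x ∈ (⋃ (γ : Γ) (i : Fin m), actImg j ρ γ (D i))ᶜ,
      IsFundDom j ρ
        (closure (connectedComponentIn (⋃ (γ : Γ) (i : Fin m), actImg j ρ γ (D i))ᶜ x))

/-- The action admits a fundamental domain bounded by pairwise disjoint
left AdS crooked planes. -/
def AdmitsLeftCrookedFD (j ρ : Γ →* PSL2) : Prop :=
  ∃ (m : ℕ) (D : Fin m → Set PSL2), (∀ i, IsLeftCrookedPlane (D i)) ∧
    (∀ (γ γ' : Γ) (i i' : Fin m),
      actImg j ρ γ (D i) = actImg j ρ γ' (D i') ∨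
      Disjoint (actImg j ρ γ (D i)) (actImg j ρ γ' (D i'))) ∧
    ∃ x ∈ (⋃ (γ : Γ) (i : Fin m), actImg j ρ γ (D i))ᶜ,
      IsFundDom j ρ
        (closure (connectedComponentIn (⋃ (γ : Γ) (i : Fin m), actImg j ρ γ (D i))ᶜ x))

/-- The translation length `λ(g) = inf_{p ∈ ℍ} d(p, g·p)`. -/
def transLength (g : PSL2) : ℝ := ⨅ p : ℍ, dist p (pslSMul g p)

/-- `U` is a connected component of `S`. -/
def IsCC (S U : Set ℍ) : Prop := ∃ x ∈ S, connectedComponentIn S x = U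

/-- `ξ ∈ ℝ ∪ {∞}` is an ideal point of `U ⊆ ℍ`: a limit of a sequence of points
of `U` in the one-point compactification of `ℂ`. -/
def IsIdealPoint (U : Set ℍ) (ξ : OnePoint ℝ) : Prop :=
  ∃ u : ℕ → ℍ, (∀ n, u n ∈ U) ∧ Tendsto (fun n => embH (u n)) atTop (𝓝 (toC ξ))

/-- The closed right crooked half-space `H̄*₊(l, U)`. -/
def closedRHS (l U : Set ℍ) : Set PSL2 :=
  {h | (∃ x ∈ l ∪ U, pslSMul h x = x) ∨ ∃ ξ, IsIdealPoint U ξ ∧ HasNonattracting h ξ}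

/-- The open right crooked half-space `H*₊(l, U)`. -/
def openRHS (l U : Set ℍ) : Set PSL2 :=
  {h | h ≠ 1 ∧ ((∃ x ∈ U, pslSMul h x = x) ∨
    ∃ ξ, IsIdealPoint U ξ ∧ ¬ IsEndpoint l ξ ∧ HasNonattracting h ξ)}

/-- The circle of (Euclidean) radius `c` in `ℍ` centered at `0`; for suitable `c`
this is a geodesic line of `ℍ`. -/
def circ (c : ℝ) : Set ℍ := {z : ℍ | ‖(z : ℂ)‖ = c}

/-- The stem quadrant `SQ(ℓ)` for `ℓ = {|z| = 1/R}` transversely oriented towards `0`. -/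
def SQell (R : ℝ) : Set PSL2 :=
  {h | ∃ (A : SL2) (α β v : ℝ), (QuotientGroup.mk A : PSL2) = h ∧
    (A : Matrix (Fin 2) (Fin 2) ℝ) = !![α, -v/R; v*R, β] ∧
    |α| < |β| ∧ 2*|v| < |α - β|}

/-- The inverse stem quadrant `SQ(ℓ')⁻¹` for `ℓ' = {|z| = R}` transversely
oriented towards `∞`. -/
def SQell'inv (R : ℝ) : Set PSL2 :=
  {h | ∃ (A : SL2) (α β v : ℝ), (QuotientGroup.mk A : PSL2) = h ∧
    (A : Matrix (Fin 2) (Fin 2) ℝ) = !![α, v*R; -v/R, β] ∧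
    |α| < |β| ∧ 2*|v| < |α - β|}

/-- The stem quadrant `SQ(ℓ')`. -/
def SQell' (R : ℝ) : Set PSL2 := {h | h⁻¹ ∈ SQell'inv R}


namespace CrookedAux

open Matrix

/-- Real `2 × 2` matrices. -/
abbrev M2 := Matrix (Fin 2) (Fin 2) ℝ

/-- Polarization of the determinant. -/
def bf (X Y : M2) : ℝ := X 0 0 * Y 1 1 + X 1 1 * Y 0 0 - X 0 1 * Y 1 0 - X 1 0 * Y 0 1

/-- The symmetric matrix attached to a point of the upper half-plane. -/
def sym (z : ℍ) : M2 := !![(z.re ^ 2 + z.im ^ 2) / z.im, z.re / z.im; z.re / z.im, 1 / z.im]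

/-- The area form on the plane. -/
def cr (v w : Fin 2 → ℝ) : ℝ := v 0 * w 1 - v 1 * w 0

lemma bf_conj (A : SL2) (X Y : M2) :
    bf ((A : M2) * X * (A : M2)ᵀ) ((A : M2) * Y * (A : M2)ᵀ) = bf X Y := by
  have h : (A : M2) 0 0 * (A : M2) 1 1 - (A : M2) 0 1 * (A : M2) 1 0 = 1 := by
    have := A.det_coe; rwa [Matrix.det_fin_two] at this
  simp only [bf, Matrix.mul_apply, Fin.sum_univ_two, Matrix.transpose_apply]
  generalize (A : M2) 0 0 = a at *
  generalize (A : M2) 0 1 = b at *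
  generalize (A : M2) 1 0 = c at *
  generalize (A : M2) 1 1 = d at *
  linear_combination ((a * d - b * c + 1) * (X 0 0 * Y 1 1 + X 1 1 * Y 0 0 - X 0 1 * Y 1 0 - X 1 0 * Y 0 1)) * h

lemma det_eq (A : SL2) : (A : M2) 0 0 * (A : M2) 1 1 - (A : M2) 0 1 * (A : M2) 1 0 = 1 := by
  have := A.det_coe; rwa [Matrix.det_fin_two] at this

lemma den_pos (A : SL2) (z : ℍ) :
    0 < ((A : M2) 1 0 * z.re + (A : M2) 1 1) ^ 2 + ((A : M2) 1 0) ^ 2 * z.im ^ 2 := by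
  have h := det_eq A
  have hz := z.im_pos
  rcases eq_or_ne ((A : M2) 1 0) 0 with h0 | h0
  · have : (A : M2) 1 1 ≠ 0 := by
      intro h1; rw [h0, h1] at h; simp at h
    rw [h0]; simp; positivity
  · have : 0 < ((A : M2) 1 0) ^ 2 * z.im ^ 2 := by positivity
    nlinarith [sq_nonneg ((A : M2) 1 0 * z.re + (A : M2) 1 1)]

lemma smul_re_im (A : SL2) (z : ℍ) :
    (A • z).re = (((A : M2) 0 0 * z.re + (A : M2) 0 1) * ((A : M2) 1 0 * z.re + (A : M2) 1 1)
      + (A : M2) 0 0 * (A : M2) 1 0 * z.im ^ 2) /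
      (((A : M2) 1 0 * z.re + (A : M2) 1 1) ^ 2 + ((A : M2) 1 0) ^ 2 * z.im ^ 2) ∧
    (A • z).im = z.im /
      (((A : M2) 1 0 * z.re + (A : M2) 1 1) ^ 2 + ((A : M2) 1 0) ^ 2 * z.im ^ 2) := by
  have h := det_eq A
  have hN := den_pos A z
  have e := UpperHalfPlane.coe_specialLinearGroup_apply A z
  have hz : (z : ℂ) = ⟨z.re, z.im⟩ := rfl
  have e1 : (A • z).re = ((A • z : ℍ) : ℂ).re := rfl
  have e2 : (A • z).im = ((A • z : ℍ) : ℂ).im := rfl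
  rw [e1, e2, e]
  simp only [Complex.div_re, Complex.div_im, Complex.normSq_apply, hz]
  simp
  constructor
  · rw [← add_div]
    congr 1 <;> ring
  · rw [← sub_div]
    congr 1
    · linear_combination z.im * h
    · ring

lemma sym_smul (A : SL2) (z : ℍ) : sym (A • z) = (A : M2) * sym z * (A : M2)ᵀ := by
  have h := det_eq A
  have hN := den_pos A z
  obtain ⟨h1, h2⟩ := smul_re_im A z
  have hz := z.im_pos
  have hz' := (A • z).im_pos
  ext i j
  fin_cases i <;> fin_cases j <;>
    simp [sym, Matrix.mul_apply, Fin.sum_univ_two, h1, h2]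
  all_goals
    generalize (A : M2) 0 0 = a at *
    generalize (A : M2) 0 1 = b at *
    generalize (A : M2) 1 0 = c at *
    generalize (A : M2) 1 1 = d at *
    generalize z.re = x at *
    generalize z.im = y at *
    clear h1 h2 hz'
  · generalize hN' : (c * x + d) ^ 2 + c ^ 2 * y ^ 2 = N at *
    have : ((a * x + b) * (c * x + d) + a * c * y ^ 2) ^ 2 + y ^ 2
        = N * ((a * x + b) ^ 2 + a ^ 2 * y ^ 2) := by
      rw [← hN']
      linear_combination (-(y ^ 2)) * (a * d - b * c + 1) * h
    field_simp
    linear_combination this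
  · generalize hN' : (c * x + d) ^ 2 + c ^ 2 * y ^ 2 = N at *
    field_simp; ring
  · generalize hN' : (c * x + d) ^ 2 + c ^ 2 * y ^ 2 = N at *
    field_simp; ring
  · field_simp; ring

lemma cosh_dist_bf (z w : ℍ) : 2 * Real.cosh (dist z w) = bf (sym z) (sym w) := by
  rw [UpperHalfPlane.cosh_dist']
  have := z.im_pos
  have := w.im_pos
  simp [bf, sym]
  field_simp
  ring

lemma bf_outer (v w : Fin 2 → ℝ) : bf (vecMulVec v v) (vecMulVec w w) = (cr v w) ^ 2 := by
  simp [bf, cr, vecMulVec_apply]; ring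

lemma conj_outer (A : M2) (v : Fin 2 → ℝ) :
    A * vecMulVec v v * Aᵀ = vecMulVec (A *ᵥ v) (A *ᵥ v) := by
  rw [Matrix.mul_vecMulVec, Matrix.vecMulVec_mul, Matrix.vecMul_transpose]

lemma bf_add_left (X Y Z : M2) : bf (X + Y) Z = bf X Z + bf Y Z := by
  simp [bf]; ring

lemma bf_add_right (X Y Z : M2) : bf Z (X + Y) = bf Z X + bf Z Y := by
  simp [bf]; ring

lemma bf_smul_left (c : ℝ) (X Z : M2) : bf (c • X) Z = c * bf X Z := by
  simp [bf]; ring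

lemma bf_smul_right (c : ℝ) (X Z : M2) : bf Z (c • X) = c * bf Z X := by
  simp [bf]; ring

lemma cr_conj (A : SL2) (v w : Fin 2 → ℝ) :
    cr ((A : M2) *ᵥ v) ((A : M2) *ᵥ w) = cr v w := by
  have h := det_eq A
  simp [cr, Matrix.mulVec, dotProduct, Fin.sum_univ_two]
  linear_combination (v 0 * w 1 - v 1 * w 0) * h

lemma exists_two (v w p q : Fin 2 → ℝ) (h : cr v w = cr p q) (h0 : cr v w ≠ 0) :
    ∃ K : SL2, (K : M2) *ᵥ v = p ∧ (K : M2) *ᵥ w = q := by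
  refine ⟨⟨(cr v w)⁻¹ • (!![p 0, q 0; p 1, q 1] * !![w 1, - w 0; - v 1, v 0]), ?_⟩, ?_, ?_⟩
  · rw [Matrix.det_smul, Matrix.det_mul, Matrix.det_fin_two_of, Matrix.det_fin_two_of]
    have e1 : p 0 * q 1 - q 0 * p 1 = cr v w := by rw [h, cr]; ring
    have e2 : w 1 * v 0 - - w 0 * - v 1 = cr v w := by rw [cr]; ring
    rw [e1, e2]; simp; field_simp
  · ext i
    fin_cases i <;>
    · simp [Matrix.mulVec, dotProduct, Fin.sum_univ_two]
      field_simp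
      simp only [cr]; ring
  · ext i
    fin_cases i <;>
    · simp [Matrix.mulVec, dotProduct, Fin.sum_univ_two]
      field_simp
      simp only [cr]; ring

lemma exists_compl (v : Fin 2 → ℝ) (h : v ≠ 0) : ∃ w, cr v w = 1 := by
  have : 0 < v 0 ^ 2 + v 1 ^ 2 := by
    by_contra hc
    apply h
    have h0 : v 0 = 0 := by nlinarith [sq_nonneg (v 0), sq_nonneg (v 1)]
    have h1 : v 1 = 0 := by nlinarith [sq_nonneg (v 0), sq_nonneg (v 1)]
    ext i; fin_cases i <;> simp [h0, h1]
  refine ⟨![- v 1 / (v 0 ^ 2 + v 1 ^ 2), v 0 / (v 0 ^ 2 + v 1 ^ 2)], ?_⟩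
  simp [cr]; field_simp; ring

lemma exists_one (v p : Fin 2 → ℝ) (hv : v ≠ 0) (hp : p ≠ 0) :
    ∃ K : SL2, (K : M2) *ᵥ v = p := by
  obtain ⟨w, hw⟩ := exists_compl v hv
  obtain ⟨q, hq⟩ := exists_compl p hp
  obtain ⟨K, h, -⟩ := exists_two v w p q (hw.trans hq.symm) (by simp [hw])
  exact ⟨K, h⟩

lemma parallel (v w : Fin 2 → ℝ) (hv : v ≠ 0) (hw : w ≠ 0) (h : cr v w = 0) :
    ∃ c : ℝ, c ≠ 0 ∧ w = c • v := by
  obtain ⟨u, hu⟩ := exists_compl v hv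
  have key : w = (cr w u) • v := by
    ext i
    simp only [cr] at *
    fin_cases i <;> simp
    · linear_combination (-(w 0)) * hu + u 0 * h
    · linear_combination (-(w 1)) * hu + u 1 * h
  refine ⟨cr w u, ?_, key⟩
  intro h0; rw [h0] at key; exact hw (by simpa using key)

end CrookedAux

namespace CrookedAux

open Matrix

/-- The image under `A` of the imaginary axis. -/
def lineOf (A : SL2) : Set ℍ := {z | (A⁻¹ • z).re = 0}

/-- The image under `A` of the right quadrant. -/
def sideOf (A : SL2) : Set ℍ := {z | 0 < (A⁻¹ • z).re}

/-- Rotations about `I`. -/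
def rot (θ : ℝ) : SL2 :=
  ⟨!![Real.cos θ, Real.sin θ; -Real.sin θ, Real.cos θ], by
    rw [Matrix.det_fin_two_of]; nlinarith [Real.sin_sq_add_cos_sq θ]⟩

lemma rot_I (θ : ℝ) : (rot θ) • UpperHalfPlane.I = UpperHalfPlane.I := by
  obtain ⟨h1, h2⟩ := smul_re_im (rot θ) UpperHalfPlane.I
  have := Real.sin_sq_add_cos_sq θ
  apply UpperHalfPlane.ext
  apply Complex.ext
  · rw [UpperHalfPlane.coe_re, h1]; simp [rot]; ring
  · rw [UpperHalfPlane.coe_im, h2]; simp [rot]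

lemma exists_rot (w : ℍ) : ∃ θ, (rot θ • w).re = 0 := by
  let f : ℝ → ℝ := fun θ => (Real.cos θ * w.re + Real.sin θ) * (-Real.sin θ * w.re + Real.cos θ)
      + Real.cos θ * (-Real.sin θ) * w.im ^ 2
  have hf : Continuous f := by fun_prop
  have h0 : f 0 = w.re := by simp [f]
  have h1 : f (Real.pi / 2) = - w.re := by simp [f]
  have : (0 : ℝ) ∈ Set.uIcc (f 0) (f (Real.pi / 2)) := by
    rw [h0, h1, Set.mem_uIcc]
    rcases le_total 0 w.re with h | h
    · right; constructor <;> linarith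
    · left; constructor <;> linarith
  obtain ⟨θ, -, hθ⟩ := intermediate_value_uIcc hf.continuousOn this
  refine ⟨θ, ?_⟩
  rw [(smul_re_im (rot θ) w).1]
  simp only [f] at hθ
  simp [rot]
  left
  linarith

lemma exists_two_point (p q : ℍ) : ∃ B : SL2, B • p = UpperHalfPlane.I ∧ (B • q).re = 0 := by
  obtain ⟨θ, hθ⟩ := exists_rot (p.toSL2R⁻¹ • q)
  refine ⟨rot θ * p.toSL2R⁻¹, ?_, ?_⟩
  · rw [mul_smul]
    nth_rewrite 2 [← p.toSL2R_smul_I]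
    rw [inv_smul_smul, rot_I]
  · rw [mul_smul]; exact hθ

lemma axis_of_isometry (γ : ℝ → ℍ) (hγ : Isometry γ) (h0 : γ 0 = UpperHalfPlane.I)
    (h1 : (γ 1).re = 0) : Set.range γ = {z | z.re = 0} := by
  have d0 : ∀ t, Real.cosh t = ((γ t).re ^ 2 + (γ t).im ^ 2 + 1) / (2 * (γ t).im) := by
    intro t
    have := UpperHalfPlane.cosh_dist' (γ t) (γ 0)
    rw [hγ.dist_eq, Real.dist_eq, h0] at this
    simpa using this
  have d1 : ∀ t, Real.cosh (t - 1) =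
      ((γ t).re ^ 2 + (γ t).im ^ 2 + (γ 1).im ^ 2) / (2 * (γ t).im * (γ 1).im) := by
    intro t
    have := UpperHalfPlane.cosh_dist' (γ t) (γ 1)
    rw [hγ.dist_eq, Real.dist_eq, h1] at this
    simpa using this
  have hy := (γ 1).im_pos
  set y1 := (γ 1).im with hy1
  have hs : ∃ σ : ℝ, (σ = 1 ∨ σ = -1) ∧ y1 = Real.exp σ := by
    have e := d0 1
    rw [h1, ← hy1, Real.cosh_eq, Real.exp_neg] at e
    have he := Real.exp_pos 1
    have : (y1 - Real.exp 1) * (y1 * Real.exp 1 - 1) = 0 := by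
      field_simp at e
      linear_combination (-1) * e
    rcases mul_eq_zero.mp this with h | h
    · exact ⟨1, Or.inl rfl, by linarith⟩
    · refine ⟨-1, Or.inr rfl, ?_⟩
      rw [Real.exp_neg]; field_simp; linarith
  obtain ⟨σ, hσ, hyσ⟩ := hs
  have key : ∀ t, (γ t).re = 0 ∧ (γ t).im = Real.exp (σ * t) := by
    intro t
    have hE := Real.exp_pos (σ * t)
    have c0 : Real.cosh t = (Real.exp (σ * t) + (Real.exp (σ * t))⁻¹) / 2 := by
      rw [← Real.exp_neg, ← Real.cosh_eq]
      rcases hσ with h | h <;> simp [h]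
    have c1 : Real.cosh (t - 1) = (Real.exp (σ * t) / y1 + y1 / (Real.exp (σ * t))) / 2 := by
      rw [hyσ, ← Real.exp_sub, ← Real.exp_sub]
      have : σ - σ * t = -(σ * t - σ) := by ring
      rw [this, ← Real.cosh_eq]
      rcases hσ with h | h
      · simp [h]
      · rw [← Real.cosh_neg]; congr 1; rw [h]; ring
    have e0 := d0 t
    have e1 := d1 t
    rw [c0] at e0
    rw [c1] at e1
    have hyt := (γ t).im_pos
    have hne : y1 ^ 2 - 1 ≠ 0 := by
      intro h
      have : y1 = 1 := by nlinarith
      rw [hyσ] at this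
      have := Real.exp_eq_one_iff σ |>.mp this
      rcases hσ with h | h <;> rw [h] at this <;> norm_num at this
    generalize Real.exp (σ * t) = E at *
    generalize (γ t).im = y at *
    generalize (γ t).re = x at *
    have hy2 : y = E := by
      field_simp at e0 e1
      have : (y1 ^ 2 - 1) * (y - E) = 0 := by linear_combination e1 - e0
      rcases mul_eq_zero.mp this with h | h
      · exact absurd h hne
      · linarith
    refine ⟨?_, hy2⟩
    subst hy2
    field_simp at e0
    have : y * x ^ 2 = 0 := by linear_combination (-y) * e0
    simpa [hyt.ne'] using this
  ext z
  constructor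
  · rintro ⟨t, rfl⟩; exact (key t).1
  · intro hz
    have hz : z.re = 0 := hz
    refine ⟨σ * Real.log z.im, ?_⟩
    obtain ⟨k1, k2⟩ := key (σ * Real.log z.im)
    have : σ * (σ * Real.log z.im) = Real.log z.im := by
      rcases hσ with h | h <;> rw [h] <;> ring
    rw [this, Real.exp_log z.im_pos] at k2
    apply UpperHalfPlane.ext
    apply Complex.ext
    · simpa [hz] using k1
    · simpa using k2

lemma line_eq (l : Set ℍ) (hl : IsGeodesicLine l) : ∃ A, l = lineOf A := by
  obtain ⟨γ, hγ, rfl⟩ := hl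
  obtain ⟨B, hB0, hB1⟩ := exists_two_point (γ 0) (γ 1)
  have h := axis_of_isometry (fun t => B • γ t) ((isometry_smul ℍ B).comp hγ) hB0 hB1
  refine ⟨B⁻¹, ?_⟩
  ext z
  simp only [lineOf, inv_inv, Set.mem_ofPred_eq]
  have : (B • z).re = 0 ↔ B • z ∈ Set.range fun t => B • γ t := by rw [h]; rfl
  rw [this]
  constructor
  · rintro ⟨t, rfl⟩; exact ⟨t, rfl⟩
  · rintro ⟨t, ht⟩; exact ⟨t, smul_left_cancel B ht⟩

lemma cont_re (A : SL2) : Continuous fun z : ℍ => (A • z).re :=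
  UpperHalfPlane.continuous_re.comp ((isometry_smul ℍ A).continuous)

lemma preconn_quadrant : IsPreconnected {z : ℍ | 0 < z.re} := by
  have hc : Convex ℝ {z : ℂ | 0 < z.re ∧ 0 < z.im} :=
    (convex_halfSpace_re_gt 0).inter (convex_halfSpace_im_gt 0)
  have := hc.isPreconnected
  rw [← UpperHalfPlane.isEmbedding_coe.toIsInducing.isPreconnected_image]
  convert this using 1
  ext z
  constructor
  · rintro ⟨w, hw, rfl⟩; exact ⟨hw, w.im_pos⟩
  · rintro ⟨h1, h2⟩; exact ⟨⟨z, h2⟩, h1, rfl⟩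

lemma preconn_side (A : SL2) : IsPreconnected (sideOf A) := by
  have : sideOf A = (fun z => A • z) '' {z : ℍ | 0 < z.re} := by
    ext z
    constructor
    · intro h; exact ⟨A⁻¹ • z, h, by simp⟩
    · rintro ⟨w, hw, rfl⟩; simpa [sideOf] using hw
  rw [this]
  exact preconn_quadrant.image _ (isometry_smul ℍ A).continuous.continuousOn

/-- The quarter turn. -/
def Sw : SL2 := rot (Real.pi / 2)

lemma Sw_inv_re (z : ℍ) : (Sw⁻¹ • z).re = - z.re / (z.re ^ 2 + z.im ^ 2) := by
  rw [(smul_re_im _ z).1]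
  have : ((Sw⁻¹ : SL2) : M2) = !![0, -1; 1, 0] := by
    rw [Matrix.SpecialLinearGroup.coe_inv]
    simp [Sw, rot, Matrix.adjugate_fin_two]
  rw [this]; simp

lemma line_Sw (A : SL2) : lineOf (A * Sw) = lineOf A := by
  ext z
  simp only [lineOf, _root_.mul_inv_rev, mul_smul, Set.mem_ofPred_eq, Sw_inv_re]
  have := (A⁻¹ • z).im_pos
  have : 0 < (A⁻¹ • z).re ^ 2 + (A⁻¹ • z).im ^ 2 := by positivity
  rw [div_eq_zero_iff]
  simp [this.ne']

lemma side_Sw (A : SL2) : sideOf (A * Sw) = {z | (A⁻¹ • z).re < 0} := by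
  ext z
  simp only [sideOf, _root_.mul_inv_rev, mul_smul, Set.mem_ofPred_eq, Sw_inv_re]
  have := (A⁻¹ • z).im_pos
  have : 0 < (A⁻¹ • z).re ^ 2 + (A⁻¹ • z).im ^ 2 := by positivity
  rw [div_pos_iff_of_pos_right this]
  simp

lemma cc_pos (A : SL2) (x : ℍ) (hx : x ∈ sideOf A) :
    connectedComponentIn (lineOf A)ᶜ x = sideOf A := by
  have hsub : sideOf A ⊆ (lineOf A)ᶜ := fun z hz h => by
    simp only [sideOf, lineOf, Set.mem_ofPred_eq] at hz h; linarith
  apply Set.Subset.antisymm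
  · intro z hz
    have hpc : IsPreconnected (connectedComponentIn (lineOf A)ᶜ x) :=
      isPreconnected_connectedComponentIn
    have hxm : x ∈ connectedComponentIn (lineOf A)ᶜ x := mem_connectedComponentIn (hsub hx)
    by_contra hneg
    have hneg : (A⁻¹ • z).re ≤ 0 := not_lt.mp hneg
    obtain ⟨w, hw, hw0⟩ := hpc.intermediate_value hz hxm (cont_re A⁻¹).continuousOn
      (show (0 : ℝ) ∈ Set.Icc _ _ from ⟨hneg, le_of_lt hx⟩)
    exact connectedComponentIn_subset _ _ hw hw0
  · exact (preconn_side A).subset_connectedComponentIn hx hsub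

lemma normal_form (l U : Set ℍ) (hl : IsGeodesicLine l) (hU : IsCC lᶜ U) :
    ∃ A, l = lineOf A ∧ U = sideOf A := by
  obtain ⟨A, rfl⟩ := line_eq l hl
  obtain ⟨x, hx, rfl⟩ := hU
  rcases lt_or_gt_of_ne (show (A⁻¹ • x).re ≠ 0 from hx) with h | h
  · refine ⟨A * Sw, (line_Sw A).symm, ?_⟩
    rw [← line_Sw A]
    exact cc_pos _ _ (by rw [side_Sw]; exact h)
  · exact ⟨A, rfl, cc_pos A x h⟩

end CrookedAux

namespace CrookedAux

open Matrix

lemma tendsto_emb_coe (u : ℕ → ℍ) (r : ℝ) :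
    Tendsto (fun n => embH (u n)) atTop (𝓝 (toC (r : OnePoint ℝ))) ↔
      Tendsto (fun n => (u n : ℂ)) atTop (𝓝 (r : ℂ)) := by
  have : toC (r : OnePoint ℝ) = ((r : ℂ) : OnePoint ℂ) := rfl
  rw [this, ← OnePoint.comap_coe_nhds (r : ℂ), tendsto_comap_iff]
  rfl

lemma tendsto_emb_infty (u : ℕ → ℍ) :
    Tendsto (fun n => embH (u n)) atTop (𝓝 (toC OnePoint.infty)) ↔
      Tendsto (fun n => (u n : ℂ)) atTop (Bornology.cobounded ℂ) := by
  have : toC OnePoint.infty = OnePoint.infty := rfl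
  rw [this, Metric.cobounded_eq_cocompact, ← coclosedCompact_eq_cocompact,
    ← OnePoint.comap_coe_nhds_infty, tendsto_comap_iff]
  rfl

lemma bvec_ne (ξ : OnePoint ℝ) : bvec ξ ≠ 0 := by
  induction ξ with
  | infty => intro h; have := congrFun h 0; simp [bvec, OnePoint.infty] at this
  | coe r => intro h; have := congrFun h 1; simp [bvec, OnePoint.some] at this

lemma bvec_infty : bvec OnePoint.infty = ![1, 0] := rfl

lemma bvec_coe (r : ℝ) : bvec (r : OnePoint ℝ) = ![r, 1] := rfl

/-- Closed quadrant minus the origin. -/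
def Quad (u : Fin 2 → ℝ) : Prop := 0 ≤ u 0 ∧ 0 ≤ u 1 ∧ u ≠ 0

lemma side_num (A : SL2) (z : ℍ) (hz : z ∈ sideOf A) :
    0 < (((A⁻¹ : SL2) : M2) 0 0 * z.re + ((A⁻¹ : SL2) : M2) 0 1) *
      (((A⁻¹ : SL2) : M2) 1 0 * z.re + ((A⁻¹ : SL2) : M2) 1 1)
      + ((A⁻¹ : SL2) : M2) 0 0 * ((A⁻¹ : SL2) : M2) 1 0 * z.im ^ 2 := by
  have hz : 0 < (A⁻¹ • z).re := hz
  rw [(smul_re_im _ z).1, div_pos_iff_of_pos_right (den_pos _ z)] at hz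
  exact hz

lemma ideal_prod (A : SL2) (ξ : OnePoint ℝ) (h : IsIdealPoint (sideOf A) ξ) :
    0 ≤ (((A⁻¹ : SL2) : M2) *ᵥ bvec ξ) 0 * (((A⁻¹ : SL2) : M2) *ᵥ bvec ξ) 1 := by
  obtain ⟨u, hu, ht⟩ := h
  have hn := fun n => side_num A (u n) (hu n)
  generalize ((A⁻¹ : SL2) : M2) = M at *
  induction ξ with
  | infty =>
    rw [tendsto_emb_infty] at ht
    have hi : Tendsto (fun n => (u n : ℂ)⁻¹) atTop (𝓝 0) := tendsto_inv₀_cobounded.comp ht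
    have hre : Tendsto (fun n => ((u n : ℂ)⁻¹).re) atTop (𝓝 0) :=
      (Complex.continuous_re.tendsto 0).comp hi
    have hsq : Tendsto (fun n => Complex.normSq ((u n : ℂ)⁻¹)) atTop (𝓝 0) := by
      have := (Complex.continuous_normSq.tendsto 0).comp hi
      rw [Complex.normSq_zero] at this
      exact this
    have hl : Tendsto (fun n => M 0 0 * M 1 0 +
        (M 0 0 * M 1 1 + M 0 1 * M 1 0) * ((u n : ℂ)⁻¹).re
        + M 0 1 * M 1 1 * Complex.normSq ((u n : ℂ)⁻¹)) atTop (𝓝 (M 0 0 * M 1 0 +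
        (M 0 0 * M 1 1 + M 0 1 * M 1 0) * 0 + M 0 1 * M 1 1 * 0)) :=
      (tendsto_const_nhds.add (hre.const_mul _)).add (hsq.const_mul _)
    have := ge_of_tendsto' hl (fun n => by
      have h1 := hn n
      have h2 := (u n).im_pos
      have h3 : 0 < (u n).re * (u n).re + (u n).im * (u n).im := by nlinarith [sq_nonneg (u n).re]
      rw [Complex.inv_re, map_inv₀, Complex.normSq_apply]
      simp only [UpperHalfPlane.coe_re, UpperHalfPlane.coe_im]
      have : M 0 0 * M 1 0 + (M 0 0 * M 1 1 + M 0 1 * M 1 0) *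
          ((u n).re / ((u n).re * (u n).re + (u n).im * (u n).im)) +
          M 0 1 * M 1 1 * ((u n).re * (u n).re + (u n).im * (u n).im)⁻¹ =
          ((M 0 0 * (u n).re + M 0 1) * (M 1 0 * (u n).re + M 1 1) +
            M 0 0 * M 1 0 * (u n).im ^ 2) / ((u n).re * (u n).re + (u n).im * (u n).im) := by
        rw [eq_div_iff h3.ne', add_mul, add_mul, mul_assoc _ (_ / _), div_mul_cancel₀ _ h3.ne',
          mul_assoc _ (_ ⁻¹), inv_mul_cancel₀ h3.ne']
        ring
      rw [this]
      exact (div_pos h1 h3).le)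
    simpa [bvec_infty, Matrix.mulVec, dotProduct, Fin.sum_univ_two] using this
  | coe r =>
    rw [tendsto_emb_coe] at ht
    have hre : Tendsto (fun n => (u n).re) atTop (𝓝 r) :=
      (Complex.continuous_re.tendsto _).comp ht
    have him : Tendsto (fun n => (u n).im) atTop (𝓝 0) :=
      (Complex.continuous_im.tendsto _).comp ht
    have hl := ((((hre.const_mul (M 0 0)).add_const (M 0 1)).mul
      ((hre.const_mul (M 1 0)).add_const (M 1 1))).add
      ((him.pow 2).const_mul (M 0 0 * M 1 0)))
    have := ge_of_tendsto' hl (fun n => (hn n).le)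
    simpa [bvec_coe, Matrix.mulVec, dotProduct, Fin.sum_univ_two] using this

lemma ideal_quad (A : SL2) (ξ : OnePoint ℝ) (h : IsIdealPoint (sideOf A) ξ) :
    ∃ u, Quad u ∧ ∃ c : ℝ, c ≠ 0 ∧ bvec ξ = c • ((A : M2) *ᵥ u) := by
  have hp := ideal_prod A ξ h
  have hA : (A : M2) *ᵥ (((A⁻¹ : SL2) : M2) *ᵥ bvec ξ) = bvec ξ := by
    rw [Matrix.mulVec_mulVec, ← Matrix.SpecialLinearGroup.coe_mul]; simp
  set w := ((A⁻¹ : SL2) : M2) *ᵥ bvec ξ with hw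
  have hw0 : w ≠ 0 := by
    intro h0; rw [h0] at hA; exact bvec_ne ξ (by simpa using hA.symm)
  rcases mul_nonneg_iff.mp hp with ⟨h1, h2⟩ | ⟨h1, h2⟩
  · exact ⟨w, ⟨h1, h2, hw0⟩, 1, one_ne_zero, by simp [hA]⟩
  · exact ⟨-w, ⟨by simpa using h1, by simpa using h2, by simpa using hw0⟩, -1, by norm_num,
      by simp [Matrix.mulVec_neg, hA]⟩

lemma quad_ideal (A : SL2) (ξ : OnePoint ℝ) (u : Fin 2 → ℝ) (hu : Quad u) (κ : ℝ)
    (h : bvec ξ = κ • ((A : M2) *ᵥ u)) : IsIdealPoint (sideOf A) ξ := by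
  obtain ⟨h0, h1, -⟩ := hu
  let ε : ℕ → ℝ := fun n => 1 / ((n : ℝ) + 1)
  have hε : ∀ n, 0 < ε n := fun n => by positivity
  have hεt : Tendsto ε atTop (𝓝 0) := tendsto_one_div_add_atTop_nhds_zero_nat
  let w : ℕ → ℍ := fun n => ⟨⟨(u 0 + ε n) / (u 1 + ε n), ε n / (u 1 + ε n)⟩, by
    have := hε n; show 0 < ε n / (u 1 + ε n); positivity⟩
  let num : ℕ → ℂ := fun n => (A : M2) 0 0 * ((u 0 : ℂ) + ε n * (1 + Complex.I))
    + (A : M2) 0 1 * ((u 1 : ℂ) + ε n)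
  let den : ℕ → ℂ := fun n => (A : M2) 1 0 * ((u 0 : ℂ) + ε n * (1 + Complex.I))
    + (A : M2) 1 1 * ((u 1 : ℂ) + ε n)
  have hεc : Tendsto (fun n => (ε n : ℂ)) atTop (𝓝 0) := by
    have := (Complex.continuous_ofReal.tendsto 0).comp hεt
    rw [Complex.ofReal_zero] at this
    exact this
  have hnum : Tendsto num atTop (𝓝 ((((A : M2) *ᵥ u) 0 : ℝ) : ℂ)) := by
    have := (((hεc.mul_const (1 + Complex.I)).const_add (u 0 : ℂ)).const_mul ((A : M2) 0 0 : ℂ)).add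
      ((hεc.const_add (u 1 : ℂ)).const_mul ((A : M2) 0 1 : ℂ))
    simpa [Matrix.mulVec, dotProduct, Fin.sum_univ_two] using this
  have hden : Tendsto den atTop (𝓝 ((((A : M2) *ᵥ u) 1 : ℝ) : ℂ)) := by
    have := (((hεc.mul_const (1 + Complex.I)).const_add (u 0 : ℂ)).const_mul ((A : M2) 1 0 : ℂ)).add
      ((hεc.const_add (u 1 : ℂ)).const_mul ((A : M2) 1 1 : ℂ))
    simpa [Matrix.mulVec, dotProduct, Fin.sum_univ_two] using this
  have hz : ∀ n, ((A • w n : ℍ) : ℂ) = num n / den n := by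
    intro n
    have hpos : 0 < u 1 + ε n := by have := hε n; positivity
    have hne : (u 1 : ℂ) + ε n ≠ 0 := by exact_mod_cast hpos.ne'
    rw [UpperHalfPlane.coe_specialLinearGroup_apply]
    have hw : (w n : ℂ) = ((u 0 : ℂ) + ε n * (1 + Complex.I)) / ((u 1 : ℂ) + ε n) := by
      have : (w n : ℂ) = ((((u 0 + ε n) / (u 1 + ε n) : ℝ) : ℂ)
        + ((ε n / (u 1 + ε n) : ℝ) : ℂ) * Complex.I) := Complex.mk_eq_add_mul_I _ _
      rw [this]; push_cast; field_simp; ring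
    rw [hw]
    simp only [num, den, Algebra.algebraMap_self, RingHom.id_apply]
    rw [← mul_div_mul_right _ _ hne, add_mul, add_mul, mul_assoc _ (_ / _), div_mul_cancel₀ _ hne,
      mul_assoc _ (_ / _), div_mul_cancel₀ _ hne]
  refine ⟨fun n => A • w n, fun n => ?_, ?_⟩
  · simp only [sideOf, Set.mem_ofPred_eq, inv_smul_smul]
    show 0 < (u 0 + ε n) / (u 1 + ε n)
    have := hε n; positivity
  · induction ξ with
    | infty =>
      rw [tendsto_emb_infty]
      have e0 := congrFun h 0
      have e1 := congrFun h 1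
      simp only [bvec_infty, Pi.smul_apply, smul_eq_mul] at e0 e1
      generalize ((A : M2) *ᵥ u) 0 = p at *
      generalize ((A : M2) *ᵥ u) 1 = q at *
      simp at e0 e1
      have hκ : κ ≠ 0 := by rintro rfl; simp at e0
      have hp : p ≠ 0 := by rintro rfl; simp at e0
      have hq : q = 0 := by simpa [hκ] using e1
      have : Tendsto (fun n => den n / num n) atTop (𝓝 0) := by
        have := hden.div hnum (by exact_mod_cast hp)
        rw [hq, Complex.ofReal_zero, zero_div] at this
        exact this
      have h2 : Tendsto (fun n => ((A • w n : ℍ) : ℂ)⁻¹) atTop (𝓝[≠] 0) := by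
        refine tendsto_nhdsWithin_iff.mpr ⟨?_, ?_⟩
        · refine this.congr fun n => ?_
          rw [hz, inv_div]
        · exact Eventually.of_forall fun n => inv_ne_zero (A • w n).ne_zero
      have h3 := (tendsto_inv₀_nhdsNE_zero (α := ℂ)).comp h2
      exact h3.congr fun n => inv_inv _
    | coe r =>
      rw [tendsto_emb_coe]
      have e0 := congrFun h 0
      have e1 := congrFun h 1
      simp only [bvec_coe, Pi.smul_apply, smul_eq_mul] at e0 e1
      generalize ((A : M2) *ᵥ u) 0 = p at *
      generalize ((A : M2) *ᵥ u) 1 = q at *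
      simp at e0 e1
      have hq : q ≠ 0 := by rintro rfl; simp at e1
      have hr : r = p / q := by
        rw [eq_div_iff hq, e0]; linear_combination (-p) * e1
      have := hnum.div hden (by exact_mod_cast hq)
      rw [hr, Complex.ofReal_div]
      exact this.congr fun n => (hz n).symm

lemma exists_ideal (v : Fin 2 → ℝ) (hv : v ≠ 0) :
    ∃ ξ, ∃ c : ℝ, c ≠ 0 ∧ bvec ξ = c • v := by
  by_cases h : v 1 = 0
  · have h0 : v 0 ≠ 0 := fun h0 => hv (by ext i; fin_cases i <;> simp [h, h0])
    refine ⟨OnePoint.infty, (v 0)⁻¹, inv_ne_zero h0, ?_⟩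
    rw [bvec_infty]; ext i; fin_cases i <;> simp [h, h0]
  · refine ⟨((v 0 / v 1 : ℝ) : OnePoint ℝ), (v 1)⁻¹, inv_ne_zero h, ?_⟩
    rw [bvec_coe]; ext i; fin_cases i <;> simp [h]
    field_simp

end CrookedAux

namespace CrookedAux

open Matrix

/-- The matrix of the area form in the bases given by the columns of two matrices. -/
def nm (A A' : SL2) (i j : Fin 2) : ℝ :=
  (A : M2) 0 i * (A' : M2) 1 j - (A : M2) 1 i * (A' : M2) 0 j

lemma nm_det (A A' : SL2) : nm A A' 0 0 * nm A A' 1 1 - nm A A' 0 1 * nm A A' 1 0 = 1 := by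
  have h := det_eq A
  have h' := det_eq A'
  simp only [nm]
  linear_combination ((A' : M2) 0 0 * (A' : M2) 1 1 - (A' : M2) 0 1 * (A' : M2) 1 0) * h + h'

lemma nm_swap (A A' : SL2) (i j : Fin 2) : nm A' A i j = - nm A A' j i := by
  simp only [nm]; ring

lemma cr_nm (A A' : SL2) (u u' : Fin 2 → ℝ) :
    cr ((A : M2) *ᵥ u) ((A' : M2) *ᵥ u') =
      u 0 * u' 0 * nm A A' 0 0 + u 0 * u' 1 * nm A A' 0 1 + u 1 * u' 0 * nm A A' 1 0
        + u 1 * u' 1 * nm A A' 1 1 := by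
  simp [cr, nm, Matrix.mulVec, dotProduct, Fin.sum_univ_two]; ring

/-- The algebraic condition equivalent to both sides of the theorem. -/
def Cond (A A' G G' : SL2) : Prop :=
  ((∀ i j, 0 < nm A A' i j) ∨ (∀ i j, nm A A' i j < 0)) ∧
    ∀ i j, |nm (G * A) (G' * A') i j| < |nm A A' i j|

lemma Quad.pos {u : Fin 2 → ℝ} (hu : Quad u) : 0 < u 0 ∨ 0 < u 1 := by
  by_contra h
  push Not at h
  obtain ⟨h0, h1, h2⟩ := hu
  apply h2
  ext i; fin_cases i
  · exact le_antisymm h.1 h0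
  · exact le_antisymm h.2 h1

lemma form_pos {u u' : Fin 2 → ℝ} (hu : Quad u) (hu' : Quad u') (a b c d : ℝ)
    (ha : 0 < a) (hb : 0 < b) (hc : 0 < c) (hd : 0 < d) :
    0 < u 0 * u' 0 * a + u 0 * u' 1 * b + u 1 * u' 0 * c + u 1 * u' 1 * d := by
  have p := hu.pos
  have p' := hu'.pos
  obtain ⟨h0, h1, -⟩ := hu
  obtain ⟨h0', h1', -⟩ := hu'
  rcases p with p | p <;> rcases p' with p' | p' <;> positivity

lemma cond_quad {A A' G G' : SL2} (h : Cond A A' G G') {u u' : Fin 2 → ℝ} (hu : Quad u)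
    (hu' : Quad u') :
    (cr ((G : M2) *ᵥ ((A : M2) *ᵥ u)) ((G' : M2) *ᵥ ((A' : M2) *ᵥ u'))) ^ 2 <
      (cr ((A : M2) *ᵥ u) ((A' : M2) *ᵥ u')) ^ 2 := by
  obtain ⟨hs, hm⟩ := h
  rw [Matrix.mulVec_mulVec, Matrix.mulVec_mulVec, ← Matrix.SpecialLinearGroup.coe_mul,
    ← Matrix.SpecialLinearGroup.coe_mul, cr_nm, cr_nm, sq_lt_sq]
  have m00 := hm 0 0
  have m01 := hm 0 1
  have m10 := hm 1 0
  have m11 := hm 1 1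
  have key := form_pos hu hu' _ _ _ _ (sub_pos.mpr m00) (sub_pos.mpr m01) (sub_pos.mpr m10)
    (sub_pos.mpr m11)
  obtain ⟨h0, h1, -⟩ := hu
  obtain ⟨h0', h1', -⟩ := hu'
  have e00 := mul_nonneg h0 h0'
  have e01 := mul_nonneg h0 h1'
  have e10 := mul_nonneg h1 h0'
  have e11 := mul_nonneg h1 h1'
  generalize u 0 * u' 0 = a at *
  generalize u 0 * u' 1 = b at *
  generalize u 1 * u' 0 = c at *
  generalize u 1 * u' 1 = d at *
  have hN : |a * nm A A' 0 0 + b * nm A A' 0 1 + c * nm A A' 1 0 + d * nm A A' 1 1| =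
      a * |nm A A' 0 0| + b * |nm A A' 0 1| + c * |nm A A' 1 0| + d * |nm A A' 1 1| := by
    rcases hs with hs | hs
    · have q00 := hs 0 0
      have q01 := hs 0 1
      have q10 := hs 1 0
      have q11 := hs 1 1
      rw [abs_of_pos q00, abs_of_pos q01, abs_of_pos q10, abs_of_pos q11, abs_of_nonneg]
      positivity
    · have q00 := hs 0 0
      have q01 := hs 0 1
      have q10 := hs 1 0
      have q11 := hs 1 1
      rw [abs_of_neg q00, abs_of_neg q01, abs_of_neg q10, abs_of_neg q11, abs_of_nonpos]
      · ring
      · nlinarith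
  have hM : |a * nm (G * A) (G' * A') 0 0 + b * nm (G * A) (G' * A') 0 1
      + c * nm (G * A) (G' * A') 1 0 + d * nm (G * A) (G' * A') 1 1| ≤
      a * |nm (G * A) (G' * A') 0 0| + b * |nm (G * A) (G' * A') 0 1|
      + c * |nm (G * A) (G' * A') 1 0| + d * |nm (G * A) (G' * A') 1 1| := by
    refine (abs_add_le _ _).trans (add_le_add ((abs_add_le _ _).trans
      (add_le_add ((abs_add_le _ _).trans (add_le_add ?_ ?_)) ?_)) ?_) <;>
    · rw [abs_mul, abs_of_nonneg (by assumption)]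
  rw [hN]
  linarith

/-- Sum of two rank one matrices. -/
def cone (v w : Fin 2 → ℝ) : M2 := vecMulVec v v + vecMulVec w w

lemma cone_conj (A : M2) (v w : Fin 2 → ℝ) : A * cone v w * Aᵀ = cone (A *ᵥ v) (A *ᵥ w) := by
  simp only [cone, Matrix.mul_add, Matrix.add_mul, conj_outer]

lemma bf_cone (v w v' w' : Fin 2 → ℝ) : bf (cone v w) (cone v' w') =
    (cr v v') ^ 2 + (cr v w') ^ 2 + (cr w v') ^ 2 + (cr w w') ^ 2 := by
  simp only [cone, bf_add_left, bf_add_right, bf_outer]; ring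

lemma closed_cone (A : SL2) (h : PSL2) (hh : h ∈ closedRHS (lineOf A) (sideOf A)) :
    ∃ H : SL2, (QuotientGroup.mk H : PSL2) = h ∧ ∃ u1 u2, Quad u1 ∧ (Quad u2 ∨ u2 = 0) ∧
      ∃ c : ℝ, 0 ≤ c ∧ c ≤ 1 ∧
        (H : M2) * cone ((A : M2) *ᵥ u1) ((A : M2) *ᵥ u2) * (H : M2)ᵀ =
          c • cone ((A : M2) *ᵥ u1) ((A : M2) *ᵥ u2) := by
  rcases hh with ⟨x, hx, hfix⟩ | ⟨ξ, hξ, H, hH, μ, hμ, hv⟩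
  · refine ⟨Quotient.out h, Quotient.out_eq h, ?_⟩
    set w := A⁻¹ • x with hw
    have hxw : x = A • w := by simp [hw]
    have hre : 0 ≤ w.re := by
      rcases hx with hx | hx
      · exact le_of_eq (Eq.symm hx)
      · exact le_of_lt hx
    have him := w.im_pos
    refine ⟨![w.re / √w.im, 1 / √w.im], ![√w.im, 0], ⟨?_, ?_, ?_⟩, Or.inl ⟨?_, ?_, ?_⟩, 1,
      zero_le_one, le_rfl, ?_⟩
    · simp; positivity
    · simp
    · intro h0; have := congrFun h0 1; simp at this
      exact absurd this (Real.sqrt_pos.mpr him).ne'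
    · simp
    · simp
    · intro h0; have := congrFun h0 0; simp at this
      exact absurd this (Real.sqrt_pos.mpr him).ne'
    · have hs : sym w = cone ![w.re / √w.im, 1 / √w.im] ![√w.im, 0] := by
        have h1 := Real.mul_self_sqrt him.le
        have h2 := Real.sqrt_pos.mpr him
        ext i j
        fin_cases i <;> fin_cases j <;> simp [sym, cone, vecMulVec_apply]
        · rw [div_mul_div_comm, h1]; field_simp
        · rw [div_mul_eq_mul_div, ← div_eq_mul_inv, div_div, h1]
        · rw [mul_div_assoc', mul_comm, ← div_eq_mul_inv, div_div, h1]
        · rw [← mul_inv, h1]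
      rw [← cone_conj, ← hs, ← sym_smul, ← hxw, ← sym_smul, one_smul]
      exact congrArg sym hfix
  · obtain ⟨u, hu, c, hc, hb⟩ := ideal_quad A ξ hξ
    refine ⟨H, hH, u, 0, hu, Or.inr rfl, μ ^ 2, sq_nonneg _, ?_, ?_⟩
    · rw [← sq_abs]; exact pow_le_one₀ (abs_nonneg _) hμ
    · have hv' : (H : M2) *ᵥ ((A : M2) *ᵥ u) = μ • ((A : M2) *ᵥ u) := by
        have : (A : M2) *ᵥ u = c⁻¹ • bvec ξ := by rw [hb, smul_smul, inv_mul_cancel₀ hc, one_smul]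
        rw [this, Matrix.mulVec_smul, hv, smul_comm]
      rw [cone_conj, hv', Matrix.mulVec_zero, Matrix.mulVec_zero]
      generalize (A : M2) *ᵥ u = v
      ext i j
      simp only [cone, vecMulVec_apply, Matrix.add_apply, Matrix.smul_apply, Pi.smul_apply,
        smul_eq_mul, Pi.zero_apply]
      ring

lemma disj_of_cond (A A' : SL2) (g g' : PSL2)
    (h : Cond A A' (Quotient.out g) (Quotient.out g')) :
    Disjoint ((g * ·) '' closedRHS (lineOf A) (sideOf A))
      ((g' * ·) '' closedRHS (lineOf A') (sideOf A')) := by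
  rw [Set.disjoint_left]
  rintro _ ⟨k, hk, rfl⟩ ⟨k', hk', he⟩
  obtain ⟨H, rfl, u1, u2, hu1, hu2, c, hc0, hc1, hX⟩ := closed_cone A k hk
  obtain ⟨H', rfl, u1', u2', hu1', hu2', c', hc0', hc1', hX'⟩ := closed_cone A' k' hk'
  set G : SL2 := Quotient.out g with hG
  set G' : SL2 := Quotient.out g' with hG'
  have hg : (QuotientGroup.mk G : PSL2) = g := Quotient.out_eq g
  have hg' : (QuotientGroup.mk G' : PSL2) = g' := Quotient.out_eq g'
  have he' : (QuotientGroup.mk (G * H) : PSL2) = QuotientGroup.mk (G' * H') := by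
    rw [QuotientGroup.mk_mul, QuotientGroup.mk_mul, hg, hg']; exact he.symm
  rw [QuotientGroup.eq, Matrix.SpecialLinearGroup.mem_center_iff] at he'
  obtain ⟨r, hr, hr'⟩ := he'
  have hr2 : r ^ 2 = 1 := by simpa using hr
  have hK : ((G' * H' : SL2) : M2) = r • ((G * H : SL2) : M2) := by
    have : G' * H' = (G * H) * ((G * H)⁻¹ * (G' * H')) := by group
    rw [this, Matrix.SpecialLinearGroup.coe_mul (G * H), ← hr']
    ext i j
    simp [mul_comm]
  set X := cone ((A : M2) *ᵥ u1) ((A : M2) *ᵥ u2) with hXd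
  set X' := cone ((A' : M2) *ᵥ u1') ((A' : M2) *ᵥ u2') with hXd'
  have e1 : ((G * H : SL2) : M2) * X * ((G * H : SL2) : M2)ᵀ = c • ((G : M2) * X * (G : M2)ᵀ) := by
    rw [Matrix.SpecialLinearGroup.coe_mul, Matrix.transpose_mul]
    calc _ = (G : M2) * ((H : M2) * X * (H : M2)ᵀ) * (G : M2)ᵀ := by simp only [Matrix.mul_assoc]
      _ = _ := by rw [hX]; simp
  have e2 : ((G * H : SL2) : M2) * X' * ((G * H : SL2) : M2)ᵀ
      = c' • ((G' : M2) * X' * (G' : M2)ᵀ) := by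
    have : ((G' * H' : SL2) : M2) * X' * ((G' * H' : SL2) : M2)ᵀ
        = ((G * H : SL2) : M2) * X' * ((G * H : SL2) : M2)ᵀ := by
      rw [hK, Matrix.transpose_smul]
      simp only [Matrix.smul_mul, Matrix.mul_smul, smul_smul]
      rw [← sq, hr2, one_smul]
    rw [← this, Matrix.SpecialLinearGroup.coe_mul, Matrix.transpose_mul]
    calc _ = (G' : M2) * ((H' : M2) * X' * (H' : M2)ᵀ) * (G' : M2)ᵀ := by
          simp only [Matrix.mul_assoc]
      _ = _ := by rw [hX']; simp
  have e3 := bf_conj (G * H) X X'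
  rw [e1, e2, bf_smul_left, bf_smul_right] at e3
  have hpos : 0 ≤ bf ((G : M2) * X * (G : M2)ᵀ) ((G' : M2) * X' * (G' : M2)ᵀ) := by
    rw [hXd, hXd', cone_conj, cone_conj, bf_cone]; positivity
  have hlt : bf ((G : M2) * X * (G : M2)ᵀ) ((G' : M2) * X' * (G' : M2)ᵀ) < bf X X' := by
    rw [hXd, hXd', cone_conj, cone_conj, bf_cone, bf_cone]
    have z0 : ∀ w, cr 0 w = 0 := fun w => by simp [cr]
    have z1 : ∀ w, cr w 0 = 0 := fun w => by simp [cr]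
    have f1 := cond_quad h hu1 hu1'
    have f2 : (cr ((G : M2) *ᵥ ((A : M2) *ᵥ u1)) ((G' : M2) *ᵥ ((A' : M2) *ᵥ u2'))) ^ 2 ≤
      (cr ((A : M2) *ᵥ u1) ((A' : M2) *ᵥ u2')) ^ 2 := by
      rcases hu2' with h2 | h2
      · exact (cond_quad h hu1 h2).le
      · simp [h2, z1]
    have f3 : (cr ((G : M2) *ᵥ ((A : M2) *ᵥ u2)) ((G' : M2) *ᵥ ((A' : M2) *ᵥ u1'))) ^ 2 ≤
      (cr ((A : M2) *ᵥ u2) ((A' : M2) *ᵥ u1')) ^ 2 := by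
      rcases hu2 with h2 | h2
      · exact (cond_quad h h2 hu1').le
      · simp [h2, z0]
    have f4 : (cr ((G : M2) *ᵥ ((A : M2) *ᵥ u2)) ((G' : M2) *ᵥ ((A' : M2) *ᵥ u2'))) ^ 2 ≤
      (cr ((A : M2) *ᵥ u2) ((A' : M2) *ᵥ u2')) ^ 2 := by
      rcases hu2 with h2 | h2
      · rcases hu2' with h3 | h3
        · exact (cond_quad h h2 h3).le
        · simp [h3, z1]
      · simp [h2, z0]
    linarith
  nlinarith [mul_le_one₀ hc1 hc0' hc1', mul_nonneg hc0 hc0']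

end CrookedAux

namespace CrookedAux

open Matrix

lemma mem_closed (A H : SL2) (u : Fin 2 → ℝ) (hu : Quad u) (μ : ℝ) (hμ : |μ| ≤ 1)
    (h : (H : M2) *ᵥ ((A : M2) *ᵥ u) = μ • ((A : M2) *ᵥ u)) :
    (QuotientGroup.mk H : PSL2) ∈ closedRHS (lineOf A) (sideOf A) := by
  have hv : (A : M2) *ᵥ u ≠ 0 := by
    intro h0
    apply hu.2.2
    have : ((A⁻¹ : SL2) : M2) *ᵥ ((A : M2) *ᵥ u) = u := by
      rw [Matrix.mulVec_mulVec, ← Matrix.SpecialLinearGroup.coe_mul]; simp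
    rw [← this, h0, Matrix.mulVec_zero]
  obtain ⟨ξ, c, hc, hb⟩ := exists_ideal _ hv
  refine Or.inr ⟨ξ, quad_ideal A ξ u hu c hb, H, rfl, μ, hμ, ?_⟩
  rw [hb, Matrix.mulVec_smul, h, smul_comm]

lemma mulVec_ne (A : SL2) (u : Fin 2 → ℝ) (hu : u ≠ 0) : (A : M2) *ᵥ u ≠ 0 := by
  intro h0
  apply hu
  have : ((A⁻¹ : SL2) : M2) *ᵥ ((A : M2) *ᵥ u) = u := by
    rw [Matrix.mulVec_mulVec, ← Matrix.SpecialLinearGroup.coe_mul]; simp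
  rw [← this, h0, Matrix.mulVec_zero]

lemma no_K (A A' : SL2) (g g' : PSL2)
    (h : Disjoint ((g * ·) '' closedRHS (lineOf A) (sideOf A))
      ((g' * ·) '' closedRHS (lineOf A') (sideOf A')))
    (u u' : Fin 2 → ℝ) (hu : Quad u) (hu' : Quad u') (K : SL2) (a b : ℝ) (ha : |a| ≤ 1)
    (hb : |b| ≤ 1)
    (h1 : (K : M2) *ᵥ ((A : M2) *ᵥ u) = a • (((Quotient.out g : SL2) : M2) *ᵥ ((A : M2) *ᵥ u)))
    (h2 : (K : M2) *ᵥ ((A' : M2) *ᵥ u') =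
      b • (((Quotient.out g' : SL2) : M2) *ᵥ ((A' : M2) *ᵥ u'))) : False := by
  have main : ∀ (B : SL2) (k : PSL2) (w : Fin 2 → ℝ) (c : ℝ), Quad w → |c| ≤ 1 →
      (K : M2) *ᵥ ((B : M2) *ᵥ w) = c • (((Quotient.out k : SL2) : M2) *ᵥ ((B : M2) *ᵥ w)) →
      (QuotientGroup.mk K : PSL2) ∈ (k * ·) '' closedRHS (lineOf B) (sideOf B) := by
    intro B k w c hw hc he
    refine ⟨QuotientGroup.mk ((Quotient.out k : SL2)⁻¹ * K), mem_closed B _ w hw c hc ?_, ?_⟩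
    · rw [Matrix.SpecialLinearGroup.coe_mul, ← Matrix.mulVec_mulVec, he, Matrix.mulVec_smul,
        Matrix.mulVec_mulVec (v := (B : M2) *ᵥ w), ← Matrix.SpecialLinearGroup.coe_mul]
      simp
    · have hk : (QuotientGroup.mk (Quotient.out k : SL2) : PSL2) = k := Quotient.out_eq k
      show k * _ = _
      rw [QuotientGroup.mk_mul, QuotientGroup.mk_inv, hk]
      group
  exact Set.disjoint_left.mp h (main A g u a hu ha h1) (main A' g' u' b hu' hb h2)

lemma disj_lt (A A' : SL2) (g g' : PSL2)
    (h : Disjoint ((g * ·) '' closedRHS (lineOf A) (sideOf A))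
      ((g' * ·) '' closedRHS (lineOf A') (sideOf A')))
    (u u' : Fin 2 → ℝ) (hu : Quad u) (hu' : Quad u')
    (hne : cr ((A : M2) *ᵥ u) ((A' : M2) *ᵥ u') ≠ 0) :
    (cr (((Quotient.out g : SL2) : M2) *ᵥ ((A : M2) *ᵥ u))
      (((Quotient.out g' : SL2) : M2) *ᵥ ((A' : M2) *ᵥ u'))) ^ 2 <
      (cr ((A : M2) *ᵥ u) ((A' : M2) *ᵥ u')) ^ 2 := by
  have nk := no_K A A' g g' h u u' hu hu'
  generalize (A : M2) *ᵥ u = v at *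
  generalize (A' : M2) *ᵥ u' = v' at *
  generalize ((Quotient.out g : SL2) : M2) *ᵥ v = p at *
  generalize ((Quotient.out g' : SL2) : M2) *ᵥ v' = q at *
  by_contra hc
  rw [not_lt, sq_le_sq] at hc
  have hq0 : cr p q ≠ 0 := by
    intro h0; rw [h0, abs_zero] at hc
    exact hne (abs_nonpos_iff.mp hc)
  obtain ⟨K, hK1, hK2⟩ := exists_two v v' p ((cr v v' / cr p q) • q) (by
    have : cr p ((cr v v' / cr p q) • q) = cr v v' / cr p q * cr p q := by simp [cr]; ring
    rw [this, div_mul_cancel₀ _ hq0]) hne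
  refine nk K 1 (cr v v' / cr p q) (by simp) ?_ (by simpa using hK1) hK2
  rw [abs_div]
  exact div_le_one_of_le₀ hc (abs_nonneg _)

lemma disj_ne (A A' : SL2) (g g' : PSL2)
    (h : Disjoint ((g * ·) '' closedRHS (lineOf A) (sideOf A))
      ((g' * ·) '' closedRHS (lineOf A') (sideOf A')))
    (u u' : Fin 2 → ℝ) (hu : Quad u) (hu' : Quad u') :
    cr ((A : M2) *ᵥ u) ((A' : M2) *ᵥ u') ≠ 0 := by
  intro h0
  have hv := mulVec_ne A u hu.2.2
  have hv' := mulVec_ne A' u' hu'.2.2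
  have hp := mulVec_ne (Quotient.out g : SL2) _ hv
  have hq := mulVec_ne (Quotient.out g' : SL2) _ hv'
  have h1 : cr (((Quotient.out g : SL2) : M2) *ᵥ ((A : M2) *ᵥ u))
      (((Quotient.out g' : SL2) : M2) *ᵥ ((A' : M2) *ᵥ u')) ≠ 0 := by
    intro hpq
    have nk := no_K A A' g g' h u u' hu hu'
    generalize (A : M2) *ᵥ u = v at *
    generalize (A' : M2) *ᵥ u' = v' at *
    generalize ((Quotient.out g : SL2) : M2) *ᵥ v = p at *
    generalize ((Quotient.out g' : SL2) : M2) *ᵥ v' = q at *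
    obtain ⟨c, hc, rfl⟩ := parallel v v' hv hv' h0
    obtain ⟨d, hd, rfl⟩ := parallel p q hp hq hpq
    have hcd : 0 < |c| + |d| := by positivity
    have ha : d / (|c| + |d|) ≠ 0 := div_ne_zero hd hcd.ne'
    obtain ⟨K, hK⟩ := exists_one v ((d / (|c| + |d|)) • p) hv (smul_ne_zero ha hp)
    refine nk K (d / (|c| + |d|)) (c / (|c| + |d|)) ?_ ?_ hK ?_
    · rw [abs_div, abs_of_pos hcd]
      exact div_le_one_of_le₀ (by linarith [abs_nonneg c]) hcd.le
    · rw [abs_div, abs_of_pos hcd]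
      exact div_le_one_of_le₀ (by linarith [abs_nonneg d]) hcd.le
    · rw [Matrix.mulVec_smul, hK, smul_smul, smul_smul]
      congr 1; ring
  have hw : ∃ w, Quad w ∧ cr ((A : M2) *ᵥ w) ((A' : M2) *ᵥ u') ≠ 0 := by
    by_contra hcon
    push Not at hcon
    have q0 : Quad ![1, 0] := ⟨by simp, by simp, fun h => by simpa using congrFun h 0⟩
    have q1 : Quad ![0, 1] := ⟨by simp, by simp, fun h => by simpa using congrFun h 1⟩
    have c0 := hcon _ q0
    have c1 := hcon _ q1
    rw [cr_nm] at c0 c1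
    simp at c0 c1
    have d := nm_det A A'
    apply hu'.2.2
    ext i
    fin_cases i
    · simp
      linear_combination (-(u' 0)) * d + nm A A' 1 1 * c0 - nm A A' 0 1 * c1
    · simp
      linear_combination (-(u' 1)) * d + nm A A' 0 0 * c1 - nm A A' 1 0 * c0
  obtain ⟨w, hw, hwne⟩ := hw
  have hlin : ∀ ε : ℝ, cr ((A : M2) *ᵥ (u + ε • w)) ((A' : M2) *ᵥ u')
      = ε * cr ((A : M2) *ᵥ w) ((A' : M2) *ᵥ u') := by
    intro ε
    rw [cr_nm] at h0 ⊢
    rw [cr_nm]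
    simp
    linear_combination h0
  have hlt : ∀ ε : ℝ, 0 < ε → (cr (((Quotient.out g : SL2) : M2) *ᵥ ((A : M2) *ᵥ (u + ε • w)))
      (((Quotient.out g' : SL2) : M2) *ᵥ ((A' : M2) *ᵥ u'))) ^ 2 ≤
      (ε * cr ((A : M2) *ᵥ w) ((A' : M2) *ᵥ u')) ^ 2 := by
    intro ε hε
    have hQ : Quad (u + ε • w) := by
      have p := hu.pos
      obtain ⟨a0, a1, -⟩ := hu
      obtain ⟨b0, b1, -⟩ := hw
      refine ⟨by simp; positivity, by simp; positivity, fun hz => ?_⟩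
      have z0 := congrFun hz 0
      have z1 := congrFun hz 1
      simp at z0 z1
      have := mul_nonneg hε.le b0
      have := mul_nonneg hε.le b1
      rcases p with p | p <;> linarith
    have := disj_lt A A' g g' h (u + ε • w) u' hQ hu' (by
      rw [hlin]; exact mul_ne_zero hε.ne' hwne)
    rw [hlin] at this
    exact this.le
  set p := cr (((Quotient.out g : SL2) : M2) *ᵥ ((A : M2) *ᵥ u))
      (((Quotient.out g' : SL2) : M2) *ᵥ ((A' : M2) *ᵥ u')) with hpdef
  set q := cr (((Quotient.out g : SL2) : M2) *ᵥ ((A : M2) *ᵥ w))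
      (((Quotient.out g' : SL2) : M2) *ᵥ ((A' : M2) *ᵥ u')) with hqdef
  set r := cr ((A : M2) *ᵥ w) ((A' : M2) *ᵥ u')
  have hlin2 : ∀ ε : ℝ, cr (((Quotient.out g : SL2) : M2) *ᵥ ((A : M2) *ᵥ (u + ε • w)))
      (((Quotient.out g' : SL2) : M2) *ᵥ ((A' : M2) *ᵥ u')) = p + ε * q := by
    intro ε
    rw [Matrix.mulVec_add, Matrix.mulVec_smul, Matrix.mulVec_add, Matrix.mulVec_smul, hpdef, hqdef]
    simp only [cr, Pi.add_apply, Pi.smul_apply, smul_eq_mul]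
    ring
  have hlim : p ^ 2 ≤ 0 := by
    have t1 : Tendsto (fun ε : ℝ => (p + ε * q) ^ 2) (𝓝[>] 0) (𝓝 ((p + 0 * q) ^ 2)) := by
      apply Tendsto.mono_left _ nhdsWithin_le_nhds
      exact Continuous.tendsto (by fun_prop) 0
    have t2 : Tendsto (fun ε : ℝ => (ε * r) ^ 2) (𝓝[>] 0) (𝓝 ((0 * r) ^ 2)) := by
      apply Tendsto.mono_left _ nhdsWithin_le_nhds
      exact Continuous.tendsto (by fun_prop) 0
    have := le_of_tendsto_of_tendsto t1 t2 (by
      filter_upwards [self_mem_nhdsWithin] with ε hε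
      have := hlt ε hε
      rwa [hlin2] at this)
    simpa using this
  exact h1 (by nlinarith [sq_nonneg p] : p = 0)

lemma cond_of_disj (A A' : SL2) (g g' : PSL2)
    (h : Disjoint ((g * ·) '' closedRHS (lineOf A) (sideOf A))
      ((g' * ·) '' closedRHS (lineOf A') (sideOf A'))) :
    Cond A A' (Quotient.out g) (Quotient.out g') := by
  have hne := disj_ne A A' g g' h
  have hlt := fun u u' hu hu' => disj_lt A A' g g' h u u' hu hu' (hne u u' hu hu')
  have q : ∀ s t : ℝ, 0 ≤ s → 0 ≤ t → 0 < s + t → Quad ![s, t] := by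
    intro s t hs ht hst
    refine ⟨by simpa, by simpa, fun h => ?_⟩
    have a := congrFun h 0
    have b := congrFun h 1
    simp at a b
    linarith
  have q0 : Quad ![1, 0] := q 1 0 (by norm_num) (by norm_num) (by norm_num)
  have q1 : Quad ![0, 1] := q 0 1 (by norm_num) (by norm_num) (by norm_num)
  have sgn : ∀ x y : ℝ, (∀ s t : ℝ, 0 ≤ s → 0 ≤ t → 0 < s + t → s * x + t * y ≠ 0) → 0 < x * y := by
    intro x y hxy
    by_contra hc
    rw [not_lt, mul_nonpos_iff] at hc
    have hx := hxy 1 0 (by norm_num) (by norm_num) (by norm_num)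
    have hy := hxy 0 1 (by norm_num) (by norm_num) (by norm_num)
    simp at hx hy
    have hx' := abs_pos.mpr hx
    refine hxy |y| |x| (abs_nonneg _) (abs_nonneg _) (by positivity) ?_
    rcases hc with ⟨h1, h2⟩ | ⟨h1, h2⟩
    · rw [abs_of_nonneg h1, abs_of_nonpos h2]; ring
    · rw [abs_of_nonneg h2, abs_of_nonpos h1]; ring
  have s0 := sgn (nm A A' 0 0) (nm A A' 1 0) (fun s t hs ht hst => by
    have := hne _ _ (q s t hs ht hst) q0
    rw [cr_nm] at this; simpa using this)
  have s1 := sgn (nm A A' 0 1) (nm A A' 1 1) (fun s t hs ht hst => by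
    have := hne _ _ (q s t hs ht hst) q1
    rw [cr_nm] at this; simpa using this)
  have s2 := sgn (nm A A' 0 0) (nm A A' 0 1) (fun s t hs ht hst => by
    have := hne _ _ q0 (q s t hs ht hst)
    rw [cr_nm] at this; simpa using this)
  have hlt' : ∀ u u', Quad u → Quad u' →
      |cr (((Quotient.out g * A : SL2) : M2) *ᵥ u) (((Quotient.out g' * A' : SL2) : M2) *ᵥ u')| <
      |cr ((A : M2) *ᵥ u) ((A' : M2) *ᵥ u')| := by
    intro u u' hu hu'
    have := hlt u u' hu hu'
    rw [sq_lt_sq, Matrix.mulVec_mulVec, Matrix.mulVec_mulVec, ← Matrix.SpecialLinearGroup.coe_mul,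
      ← Matrix.SpecialLinearGroup.coe_mul] at this
    exact this
  refine ⟨?_, ?_⟩
  · rcases lt_or_gt_of_ne (left_ne_zero_of_mul s0.ne') with hh | hh
    · right
      have a := neg_of_mul_pos_right s0 hh.le
      have b := neg_of_mul_pos_right s2 hh.le
      have c := neg_of_mul_pos_right s1 b.le
      intro i j; fin_cases i <;> fin_cases j <;> assumption
    · left
      have a := pos_of_mul_pos_right s0 hh.le
      have b := pos_of_mul_pos_right s2 hh.le
      have c := pos_of_mul_pos_right s1 b.le
      intro i j; fin_cases i <;> fin_cases j <;> assumption
  · have b00 := hlt' _ _ q0 q0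
    have b01 := hlt' _ _ q0 q1
    have b10 := hlt' _ _ q1 q0
    have b11 := hlt' _ _ q1 q1
    rw [cr_nm, cr_nm] at b00 b01 b10 b11
    simp at b00 b01 b10 b11
    intro i j; fin_cases i <;> fin_cases j <;> assumption

end CrookedAux

namespace CrookedAux

open Matrix

/-- The quadratic expression giving twice the hyperbolic cosine of distances between lines. -/
def qf (n : Fin 2 → Fin 2 → ℝ) (p q : ℝ) : ℝ :=
  p * n 0 0 ^ 2 + q * n 0 1 ^ 2 + n 1 0 ^ 2 / q + n 1 1 ^ 2 / p

lemma dist_line (P P' : SL2) (w w' : ℍ) (hw : w.re = 0) (hw' : w'.re = 0) :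
    2 * Real.cosh (dist (P • w) (P' • w')) = qf (nm P P') (w.im * w'.im) (w.im / w'.im) := by
  rw [cosh_dist_bf, sym_smul, sym_smul]
  have h1 := w.im_pos
  have h2 := w'.im_pos
  simp [bf, sym, Matrix.mul_apply, Fin.sum_univ_two, hw, hw', qf, nm]
  field_simp
  ring

lemma exists_param (A A' : SL2) (p q : ℝ) (hp : 0 < p) (hq : 0 < q) :
    ∃ w w' : ℍ, A • w ∈ lineOf A ∧ A' • w' ∈ lineOf A' ∧ w.re = 0 ∧ w'.re = 0 ∧
      w.im * w'.im = p ∧ w.im / w'.im = q := by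
  have h1 : 0 < Real.sqrt (p * q) := Real.sqrt_pos.2 (by positivity)
  have h2 : 0 < Real.sqrt (p / q) := Real.sqrt_pos.2 (by positivity)
  refine ⟨⟨⟨0, Real.sqrt (p * q)⟩, h1⟩, ⟨⟨0, Real.sqrt (p / q)⟩, h2⟩, ?_, ?_, rfl, rfl, ?_, ?_⟩
  · change (A⁻¹ • A • _ : ℍ).re = 0
    rw [inv_smul_smul]; rfl
  · change (A'⁻¹ • A' • _ : ℍ).re = 0
    rw [inv_smul_smul]; rfl
  · change Real.sqrt (p * q) * Real.sqrt (p / q) = p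
    rw [← Real.sqrt_mul (by positivity)]
    rw [show p * q * (p / q) = p ^ 2 by field_simp]
    exact Real.sqrt_sq hp.le
  · change Real.sqrt (p * q) / Real.sqrt (p / q) = q
    rw [← Real.sqrt_div (by positivity)]
    rw [show p * q / (p / q) = q ^ 2 by field_simp]
    exact Real.sqrt_sq hq.le

lemma orient_re (A A' : SL2) (w : ℍ) (hw : w.re = 0) :
    (A⁻¹ • A' • w).re / (A⁻¹ • A' • w).im =
      -(w.im * (nm A A' 1 0 * nm A A' 0 0) + nm A A' 1 1 * nm A A' 0 1 / w.im) := by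
  have h1 := w.im_pos
  have e : (A⁻¹ • A' • w).re / (A⁻¹ • A' • w).im = sym ((A⁻¹ * A') • w) 0 1 := by
    rw [mul_smul]; simp [sym]
  rw [e, sym_smul]
  have i00 : ((A⁻¹ : SL2) : M2) 0 0 = (A : M2) 1 1 := by
    simp [Matrix.SpecialLinearGroup.coe_inv, Matrix.adjugate_fin_two]
  have i01 : ((A⁻¹ : SL2) : M2) 0 1 = -(A : M2) 0 1 := by
    simp [Matrix.SpecialLinearGroup.coe_inv, Matrix.adjugate_fin_two]
  have i10 : ((A⁻¹ : SL2) : M2) 1 0 = -(A : M2) 1 0 := by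
    simp [Matrix.SpecialLinearGroup.coe_inv, Matrix.adjugate_fin_two]
  have i11 : ((A⁻¹ : SL2) : M2) 1 1 = (A : M2) 0 0 := by
    simp [Matrix.SpecialLinearGroup.coe_inv, Matrix.adjugate_fin_two]
  simp only [Matrix.SpecialLinearGroup.coe_mul, Matrix.mul_apply, Fin.sum_univ_two,
    Matrix.transpose_apply, i00, i01, i10, i11]
  simp [sym, hw, nm]
  field_simp
  ring

lemma orient_iff (A A' : SL2) : lineOf A' ∩ sideOf A = ∅ ↔
    ∀ s > 0, 0 ≤ s * (nm A A' 1 0 * nm A A' 0 0) + nm A A' 1 1 * nm A A' 0 1 / s := by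
  constructor
  · intro h s hs
    by_contra hc
    push Not at hc
    have e := orient_re A A' ⟨⟨0, s⟩, hs⟩ rfl
    have hpos : 0 < (A⁻¹ • A' • (⟨⟨0, s⟩, hs⟩ : ℍ)).re := by
      have him := (A⁻¹ • A' • (⟨⟨0, s⟩, hs⟩ : ℍ)).im_pos
      have : 0 < (A⁻¹ • A' • (⟨⟨0, s⟩, hs⟩ : ℍ)).re / (A⁻¹ • A' • (⟨⟨0, s⟩, hs⟩ : ℍ)).im := by
        rw [e]
        change 0 < -(s * (nm A A' 1 0 * nm A A' 0 0) + nm A A' 1 1 * nm A A' 0 1 / s)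
        linarith
      exact (div_pos_iff_of_pos_right him).1 this
    have : A' • (⟨⟨0, s⟩, hs⟩ : ℍ) ∈ lineOf A' ∩ sideOf A := by
      refine ⟨?_, hpos⟩
      change (A'⁻¹ • A' • _ : ℍ).re = 0
      rw [inv_smul_smul]; rfl
    rw [h] at this
    exact this
  · intro h
    rw [Set.eq_empty_iff_forall_notMem]
    rintro x ⟨hx, hx'⟩
    have hx0 : (A'⁻¹ • x).re = 0 := hx
    have hx1 : 0 < (A⁻¹ • x).re := hx'
    have e := orient_re A A' (A'⁻¹ • x) hx0
    rw [smul_inv_smul] at e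
    have := h _ (A'⁻¹ • x).im_pos
    have h2 := div_pos hx1 (A⁻¹ • x).im_pos
    linarith

lemma contr_of_cosh (c d1 d2 : ℝ) (hc : 0 < c) (hc1 : c ≤ 1) (h2 : 0 ≤ d2)
    (h : Real.cosh d1 ≤ c * Real.cosh d2) : d1 ≤ d2 - (-Real.log c) := by
  have hK : Real.exp (Real.log c) = c := Real.exp_log hc
  have hcosh : Real.cosh d2 ≤ Real.exp d2 := by
    rw [Real.cosh_eq]
    have : Real.exp (-d2) ≤ Real.exp d2 := Real.exp_le_exp.2 (by linarith)
    linarith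
  have h0 : 0 ≤ d2 + Real.log c := by
    have : Real.exp 0 ≤ Real.exp (d2 + Real.log c) := by
      rw [Real.exp_zero, Real.exp_add, hK]
      have := Real.one_le_cosh d1
      nlinarith
    exact Real.exp_le_exp.1 this
  have h3 : Real.cosh d1 ≤ Real.cosh (d2 + Real.log c) := by
    refine h.trans ?_
    rw [Real.cosh_eq (d2 + Real.log c), neg_add, Real.exp_add, Real.exp_add, hK, Real.cosh_eq]
    have h4 : 1 ≤ Real.exp (-Real.log c) := by
      rw [Real.one_le_exp_iff]
      have := Real.log_nonpos hc.le hc1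
      linarith
    have := Real.exp_pos (-d2)
    nlinarith
  have := Real.cosh_le_cosh.1 h3
  rw [abs_of_nonneg h0] at this
  linarith [le_abs_self d1]

lemma cosh_of_contr (K d1 d2 : ℝ) (h1 : 0 ≤ d1) (h : d1 ≤ d2 - K) :
    2 * Real.cosh d1 ≤ Real.exp (-K) * (2 * Real.cosh d2) + 1 := by
  rw [Real.cosh_eq, Real.cosh_eq]
  have a1 : Real.exp d1 ≤ Real.exp d2 * Real.exp (-K) := by
    rw [← Real.exp_add]; exact Real.exp_le_exp.2 (by linarith)
  have a2 : Real.exp (-d1) ≤ 1 := Real.exp_le_one_iff.2 (by linarith)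
  have a3 := Real.exp_pos (-d2)
  have a4 := Real.exp_pos (-K)
  nlinarith [mul_pos a3 a4]

lemma le_zero_of_bound (δ C : ℝ) (h : ∀ T : ℝ, 1 ≤ T → T * δ ≤ C) : δ ≤ 0 := by
  by_contra hc
  push Not at hc
  have := h (|C| / δ + 1) (by have := div_nonneg (abs_nonneg C) hc.le; linarith)
  rw [add_mul, div_mul_cancel₀ _ hc.ne'] at this
  linarith [le_abs_self C]

lemma small_val (a b ε : ℝ) (hε : 0 < ε) : ∃ p > 0, p * a ^ 2 + b ^ 2 / p ≤ 2 * |a * b| + ε := by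
  rcases eq_or_ne a 0 with ha | ha
  · refine ⟨(b ^ 2 + 1) / ε, by positivity, ?_⟩
    subst ha
    simp
    rw [div_div_eq_mul_div, div_le_iff₀ (by positivity)]
    nlinarith
  rcases eq_or_ne b 0 with hb | hb
  · refine ⟨ε / (a ^ 2 + 1), by positivity, ?_⟩
    subst hb
    simp
    rw [div_mul_eq_mul_div, div_le_iff₀ (by positivity)]
    nlinarith
  · have h1 := abs_pos.2 ha
    have h2 := abs_pos.2 hb
    refine ⟨|b| / |a|, by positivity, ?_⟩
    rw [← sq_abs a, ← sq_abs b, abs_mul]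
    have : |b| / |a| * |a| ^ 2 + |b| ^ 2 / (|b| / |a|) = 2 * (|a| * |b|) := by
      field_simp; ring
    linarith

lemma limit_entries (m n : Fin 2 → Fin 2 → ℝ) (c : ℝ) (hc : 0 < c)
    (h : ∀ p > 0, ∀ q > 0, qf m p q ≤ c * qf n p q + 1) (i j : Fin 2) :
    m i j ^ 2 ≤ c * n i j ^ 2 := by
  have key : m i j ^ 2 - c * n i j ^ 2 ≤ 0 := by
    apply le_zero_of_bound _ (c * (n 0 0 ^ 2 + n 0 1 ^ 2 + n 1 0 ^ 2 + n 1 1 ^ 2) + 1)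
    intro T hT
    have hT0 : 0 < T := by linarith
    have dn : ∀ x : ℝ, c * (x ^ 2 / T) ≤ c * x ^ 2 := fun x =>
      mul_le_mul_of_nonneg_left (div_le_self (sq_nonneg x) hT) hc.le
    have dm : ∀ x : ℝ, 0 ≤ x ^ 2 / T := fun x => by positivity
    have dd : ∀ x : ℝ, 0 ≤ c * x ^ 2 := fun x => by positivity
    fin_cases i <;> fin_cases j <;> simp only [Fin.zero_eta, Fin.mk_one, Fin.isValue]
    · have := h T hT0 1 one_pos
      simp only [qf, div_one, one_mul] at this
      have := dn (n 1 1)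
      linarith [dm (m 1 1), sq_nonneg (m 0 1), sq_nonneg (m 1 0), dd (n 0 0)]
    · have := h 1 one_pos T hT0
      simp only [qf, div_one, one_mul] at this
      have := dn (n 1 0)
      linarith [dm (m 1 0), sq_nonneg (m 0 0), sq_nonneg (m 1 1), dd (n 0 1)]
    · have := h 1 one_pos T⁻¹ (by positivity)
      simp only [qf, div_one, one_mul, div_inv_eq_mul, inv_mul_eq_div] at this
      have := dn (n 0 1)
      linarith [dm (m 0 1), sq_nonneg (m 0 0), sq_nonneg (m 1 1), dd (n 1 0)]
    · have := h T⁻¹ (by positivity) 1 one_pos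
      simp only [qf, div_one, one_mul, div_inv_eq_mul, inv_mul_eq_div] at this
      have := dn (n 0 0)
      linarith [dm (m 0 0), sq_nonneg (m 0 1), sq_nonneg (m 1 0), dd (n 1 1)]
  linarith

lemma prod_pos (n : Fin 2 → Fin 2 → ℝ) (hdet : n 0 0 * n 1 1 - n 0 1 * n 1 0 = 1) (C : ℝ)
    (hC : 1 < C) (h : ∀ p > 0, ∀ q > 0, 2 * C ≤ qf n p q) :
    0 < (n 0 0 * n 1 1) * (n 0 1 * n 1 0) := by
  by_contra hc
  push Not at hc
  have hab : |n 0 0 * n 1 1| + |n 0 1 * n 1 0| = 1 := by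
    generalize n 0 0 * n 1 1 = x at *
    generalize n 0 1 * n 1 0 = y at *
    have hx : 0 ≤ x := by nlinarith
    have hy : y ≤ 0 := by nlinarith
    rw [abs_of_nonneg hx, abs_of_nonpos hy]; linarith
  obtain ⟨p, hp, hp'⟩ := small_val (n 0 0) (n 1 1) ((C - 1) / 2) (by linarith)
  obtain ⟨q, hq, hq'⟩ := small_val (n 0 1) (n 1 0) ((C - 1) / 2) (by linarith)
  have := h p hp q hq
  simp only [qf] at this
  linarith

lemma coef_nonneg (a b : ℝ) (h : ∀ s > 0, 0 ≤ s * a + b / s) : 0 ≤ a ∧ 0 ≤ b := by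
  constructor
  · have : -a ≤ 0 := by
      apply le_zero_of_bound _ |b|
      intro T hT
      have := h T (by linarith)
      have h2 : b / T ≤ |b| := (div_le_div_of_nonneg_right (le_abs_self b) (by linarith)).trans
        (div_le_self (abs_nonneg b) hT)
      linarith
    linarith
  · have : -b ≤ 0 := by
      apply le_zero_of_bound _ |a|
      intro T hT
      have := h T⁻¹ (by positivity)
      rw [div_inv_eq_mul, inv_mul_eq_div] at this
      have h2 : a / T ≤ |a| := (div_le_div_of_nonneg_right (le_abs_self a) (by linarith)).trans
        (div_le_self (abs_nonneg a) hT)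
      linarith
    linarith

lemma exists_ratio (x y : ℝ) (h : |x| < |y|) : ∃ c, 0 < c ∧ c < 1 ∧ x ^ 2 ≤ c * y ^ 2 := by
  have hs : x ^ 2 < y ^ 2 := sq_lt_sq.2 h
  have hy : 0 < y ^ 2 := lt_of_le_of_lt (sq_nonneg x) hs
  have h1 : x ^ 2 / y ^ 2 < 1 := (div_lt_one hy).2 hs
  have h0 : 0 ≤ x ^ 2 / y ^ 2 := by positivity
  refine ⟨(x ^ 2 / y ^ 2 + 1) / 2, by linarith, by linarith, ?_⟩
  have : x ^ 2 = x ^ 2 / y ^ 2 * y ^ 2 := (div_mul_cancel₀ _ hy.ne').symm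
  nlinarith

lemma contr_of_cond (A A' : SL2) (g g' : PSL2)
    (h : Cond A A' (Quotient.out g) (Quotient.out g')) :
    (∃ K > 0, ∀ x ∈ lineOf A, ∀ x' ∈ lineOf A',
          dist (pslSMul g x) (pslSMul g' x') ≤ dist x x' - K) ∧
        lineOf A' ∩ sideOf A = ∅ ∧ lineOf A ∩ sideOf A' = ∅ := by
  obtain ⟨hs, hlt⟩ := h
  refine ⟨?_, ?_, ?_⟩
  · choose c hc0 hc1 hc using fun i j => exists_ratio _ _ (hlt i j)
    set C := max (max (c 0 0) (c 0 1)) (max (c 1 0) (c 1 1)) with hC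
    have hC0 : 0 < C := lt_max_of_lt_left (lt_max_of_lt_left (hc0 0 0))
    have hC1 : C < 1 := by simp [hC, hc1]
    have hle : ∀ i j, c i j ≤ C := by
      intro i j
      fin_cases i <;> fin_cases j <;> simp [hC]
    have hb : ∀ i j, nm (Quotient.out g * A) (Quotient.out g' * A') i j ^ 2 ≤
        C * nm A A' i j ^ 2 := fun i j =>
      (hc i j).trans (mul_le_mul_of_nonneg_right (hle i j) (sq_nonneg _))
    refine ⟨-Real.log C, by linarith [Real.log_neg hC0 hC1], ?_⟩
    intro x hx x' hx'
    apply contr_of_cosh C _ _ hC0 hC1.le dist_nonneg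
    have e1 := dist_line A A' (A⁻¹ • x) (A'⁻¹ • x') hx hx'
    have e2 := dist_line (Quotient.out g * A) (Quotient.out g' * A') (A⁻¹ • x) (A'⁻¹ • x') hx hx'
    rw [mul_smul, mul_smul, smul_inv_smul, smul_inv_smul] at e2
    rw [smul_inv_smul, smul_inv_smul] at e1
    have i1 := (A⁻¹ • x).im_pos
    have i2 := (A'⁻¹ • x').im_pos
    have hp := mul_pos i1 i2
    have hq := div_pos i1 i2
    simp only [pslSMul]
    generalize (A⁻¹ • x).im * (A'⁻¹ • x').im = p at *
    generalize (A⁻¹ • x).im / (A'⁻¹ • x').im = q at *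
    have t1 := mul_le_mul_of_nonneg_left (hb 0 0) hp.le
    have t2 := mul_le_mul_of_nonneg_left (hb 0 1) hq.le
    have t3 := div_le_div_of_nonneg_right (hb 1 0) hq.le
    have t4 := div_le_div_of_nonneg_right (hb 1 1) hp.le
    simp only [qf] at e1 e2
    rw [mul_div_assoc] at t3 t4
    nlinarith
  · rw [orient_iff]
    intro s hs0
    have a : ∀ i j k l, 0 < nm A A' i j * nm A A' k l := by
      intro i j k l
      rcases hs with hs | hs
      · exact mul_pos (hs _ _) (hs _ _)
      · exact mul_pos_of_neg_of_neg (hs _ _) (hs _ _)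
    have := mul_pos hs0 (a 1 0 0 0)
    have := div_pos (a 1 1 0 1) hs0
    linarith
  · rw [orient_iff]
    intro s hs0
    simp only [nm_swap A A', neg_mul_neg]
    have a : ∀ i j k l, 0 < nm A A' i j * nm A A' k l := by
      intro i j k l
      rcases hs with hs | hs
      · exact mul_pos (hs _ _) (hs _ _)
      · exact mul_pos_of_neg_of_neg (hs _ _) (hs _ _)
    have := mul_pos hs0 (a 0 1 0 0)
    have := div_pos (a 1 1 1 0) hs0
    linarith

lemma cond_of_contr (A A' : SL2) (g g' : PSL2) (K : ℝ) (hK : 0 < K)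
    (h : ∀ x ∈ lineOf A, ∀ x' ∈ lineOf A',
          dist (pslSMul g x) (pslSMul g' x') ≤ dist x x' - K)
    (ho : lineOf A' ∩ sideOf A = ∅) (ho' : lineOf A ∩ sideOf A' = ∅) :
    Cond A A' (Quotient.out g) (Quotient.out g') := by
  have main : ∀ p > 0, ∀ q > 0, qf (nm (Quotient.out g * A) (Quotient.out g' * A')) p q ≤
      Real.exp (-K) * qf (nm A A') p q + 1 ∧ 2 * Real.cosh K ≤ qf (nm A A') p q := by
    intro p hp q hq
    obtain ⟨w, w', hw, hw', r, r', rfl, rfl⟩ := exists_param A A' p q hp hq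
    have h1 := h _ hw _ hw'
    have e1 := dist_line A A' w w' r r'
    have e2 := dist_line (Quotient.out g * A) (Quotient.out g' * A') w w' r r'
    rw [mul_smul, mul_smul] at e2
    simp only [pslSMul] at h1
    rw [← e1, ← e2]
    refine ⟨cosh_of_contr K _ _ dist_nonneg h1, ?_⟩
    have h2 : K ≤ dist (A • w) (A' • w') := by
      have := @dist_nonneg _ _ (Quotient.out g • A • w) (Quotient.out g' • A' • w')
      linarith
    have : Real.cosh K ≤ Real.cosh (dist (A • w) (A' • w')) := by
      rw [Real.cosh_le_cosh, abs_of_pos hK, abs_of_nonneg dist_nonneg]; exact h2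
    linarith
  have hpos := prod_pos _ (nm_det A A') (Real.cosh K) (Real.one_lt_cosh.2 hK.ne')
    fun p hp q hq => (main p hp q hq).2
  have hlim := limit_entries _ _ _ (Real.exp_pos (-K)) fun p hp q hq => (main p hp q hq).1
  have hne : ∀ i j, nm A A' i j ≠ 0 := by
    intro i j h0
    fin_cases i <;> fin_cases j <;> simp only [Fin.zero_eta, Fin.mk_one, Fin.isValue] at h0 <;>
      simp [h0] at hpos
  rw [orient_iff] at ho ho'
  simp only [nm_swap A A', neg_mul_neg] at ho'
  obtain ⟨o1, o2⟩ := coef_nonneg _ _ ho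
  obtain ⟨o3, o4⟩ := coef_nonneg _ _ ho'
  refine ⟨?_, ?_⟩
  · have n00 := hne 0 0
    have n01 := hne 0 1
    have n10 := hne 1 0
    have n11 := hne 1 1
    rcases lt_or_gt_of_ne n00 with s | s
    · right
      have s10 : nm A A' 1 0 < 0 := lt_of_le_of_ne (by nlinarith) n10
      have s01 : nm A A' 0 1 < 0 := lt_of_le_of_ne (by nlinarith) n01
      have s11 : nm A A' 1 1 < 0 := lt_of_le_of_ne (by nlinarith) n11
      intro i j
      fin_cases i <;> fin_cases j <;> assumption
    · left
      have s10 : 0 < nm A A' 1 0 := lt_of_le_of_ne (by nlinarith) n10.symm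
      have s01 : 0 < nm A A' 0 1 := lt_of_le_of_ne (by nlinarith) n01.symm
      have s11 : 0 < nm A A' 1 1 := lt_of_le_of_ne (by nlinarith) n11.symm
      intro i j
      fin_cases i <;> fin_cases j <;> assumption
  · intro i j
    rw [← sq_lt_sq]
    refine (hlim i j).trans_lt ?_
    have h1 : Real.exp (-K) < 1 := Real.exp_lt_one_iff.2 (by linarith)
    have h2 : 0 < nm A A' i j ^ 2 := by have := hne i j; positivity
    nlinarith

end CrookedAux

theorem stmt6 (l l' U U' : Set ℍ) (hl : IsGeodesicLine l) (hl' : IsGeodesicLine l')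
    (hU : IsCC lᶜ U) (hU' : IsCC l'ᶜ U') (g g' : PSL2) :
    Disjoint ((g * ·) '' closedRHS l U) ((g' * ·) '' closedRHS l' U') ↔
      ((∃ K > 0, ∀ x ∈ l, ∀ x' ∈ l',
          dist (pslSMul g x) (pslSMul g' x') ≤ dist x x' - K) ∧
        l' ∩ U = ∅ ∧ l ∩ U' = ∅) := by
  obtain ⟨A, rfl, rfl⟩ := CrookedAux.normal_form l U hl hU
  obtain ⟨A', rfl, rfl⟩ := CrookedAux.normal_form l' U' hl' hU'
  constructor
  · intro h
    exact CrookedAux.contr_of_cond A A' g g' (CrookedAux.cond_of_disj A A' g g' h)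
  · rintro ⟨⟨K, hK, h⟩, ho, ho'⟩
    exact CrookedAux.disj_of_cond A A' g g' (CrookedAux.cond_of_contr A A' g g' K hK h ho ho')

end
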